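/- There exist constants C, K > 0, depending only on the family of coefficient sequences (a^{(n)}), such that for every n and every z satisfying 0 ≤ z ≤ min{C_n^{−1/5}, C_n^{−1/3}, C_n^{−2/5}, Var(G_n)^{1/2}} and (1+z²)·γ_n(z) ≤ 1, one has |ℙ(F_n > z)/(1 − Φ(z)) − 1| ≤ C·(1+z²)·γ_n(z), where C_n := ‖a^{(n)}‖_{ℓ⁴(ℤ)}² / Var(G_n) and γ_n(z) := e^{K·z·Var(G_n)^{−1/2}} · ( z^{1/2} C_n^{1/2} + (1 + z^{1/2} + z) C_n ). -/

import Mathlib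

open MeasureTheory ProbabilityTheory

/-- Standard normal distribution function Φ. -/
noncomputable def stdNormalCDF (z : ℝ) : ℝ :=
  ∫ x in Set.Iic z, Real.exp (-x ^ 2 / 2) / Real.sqrt (2 * Real.pi)

/-- The infinite weighted 2-run statistic `G = ∑_{i∈ℤ} a_i ξ_i ξ_{i+1}`, `ξ_i = (X_i + 1)/2`. -/
noncomputable def twoRunG {Ω : Type*} (X : ℤ → Ω → ℝ) (a : ℤ → ℝ) (ω : Ω) : ℝ :=
  ∑' i : ℤ, a i * ((X i ω + 1) / 2) * ((X (i + 1) ω + 1) / 2)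

/-- Mean of `G`. -/
noncomputable def twoRunMean {Ω : Type*} [MeasurableSpace Ω] (μ : Measure Ω)
    (X : ℤ → Ω → ℝ) (a : ℤ → ℝ) : ℝ :=
  ∫ ω, twoRunG X a ω ∂μ

/-- Variance of `G`. -/
noncomputable def twoRunVar {Ω : Type*} [MeasurableSpace Ω] (μ : Measure Ω)
    (X : ℤ → Ω → ℝ) (a : ℤ → ℝ) : ℝ :=
  (∫ ω, (twoRunG X a ω) ^ 2 ∂μ) - (twoRunMean μ X a) ^ 2

/-- The standardized 2-run statistic `F = (G − 𝔼[G])/√Var(G)`. -/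
noncomputable def twoRunF {Ω : Type*} [MeasurableSpace Ω] (μ : Measure Ω)
    (X : ℤ → Ω → ℝ) (a : ℤ → ℝ) (ω : Ω) : ℝ :=
  (twoRunG X a ω - twoRunMean μ X a) / Real.sqrt (twoRunVar μ X a)

/-- The quantity `C_n = ‖a^{(n)}‖²_{ℓ⁴(ℤ)} / Var(G_n)`. -/
noncomputable def twoRunC {Ω : Type*} [MeasurableSpace Ω] (μ : Measure Ω)
    (X : ℤ → Ω → ℝ) (a : ℤ → ℝ) : ℝ :=
  Real.sqrt (∑' i : ℤ, (a i) ^ 4) / twoRunVar μ X a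

/-- The quantity `γ_n(z) = e^{K·z·Var(G_n)^{−1/2}}·(z^{1/2} C_n^{1/2} + (1+z^{1/2}+z) C_n)`. -/
noncomputable def twoRunγ {Ω : Type*} [MeasurableSpace Ω] (μ : Measure Ω)
    (X : ℤ → Ω → ℝ) (a : ℤ → ℝ) (K z : ℝ) : ℝ :=
  Real.exp (K * z / Real.sqrt (twoRunVar μ X a)) *
    (Real.sqrt z * Real.sqrt (twoRunC μ X a) +
      (1 + Real.sqrt z + z) * twoRunC μ X a)


noncomputable def gp (x : ℝ) : ℝ := Real.exp (-x ^ 2 / 2) / Real.sqrt (2 * Real.pi)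
noncomputable def gQ (x : ℝ) : ℝ := 1 - stdNormalCDF x

lemma gp_pos (x : ℝ) : 0 < gp x := by unfold gp; positivity

lemma gp_cont : Continuous gp := by unfold gp; fun_prop

lemma gp_int : Integrable gp := by
  have := (integrable_exp_neg_mul_sq (b := 1/2) (by norm_num)).div_const (Real.sqrt (2 * Real.pi))
  refine this.congr (Filter.Eventually.of_forall fun x => ?_)
  simp only [gp]; congr 2; ring

lemma gp_total : ∫ x, gp x = 1 := by
  have h : ∀ x, gp x = Real.exp (-(1/2) * x^2) / Real.sqrt (2 * Real.pi) := by
    intro x; unfold gp; congr 2; ring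
  simp_rw [h]
  rw [integral_div, integral_gaussian]
  rw [show Real.pi / (1/2) = 2 * Real.pi by ring]
  exact div_self (by positivity)

lemma cdf_eq (z : ℝ) : stdNormalCDF z = ∫ x in Set.Iic z, gp x := rfl

lemma gQ_eq (z : ℝ) : gQ z = ∫ x in Set.Ioi z, gp x := by
  have := integral_add_compl (s := Set.Iic z) measurableSet_Iic gp_int
  rw [gp_total, Set.compl_Iic] at this
  rw [gQ, cdf_eq]; linarith

lemma cdf_neg (z : ℝ) : stdNormalCDF (-z) = gQ z := by
  rw [cdf_eq, gQ_eq]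
  have := integral_comp_neg_Iic (-z) gp
  rw [neg_neg] at this
  rw [← this]
  congr 1; ext x; unfold gp; simp

lemma gQ_nonneg (z : ℝ) : 0 ≤ gQ z := by
  rw [gQ_eq]; exact setIntegral_nonneg measurableSet_Ioi fun x _ => (gp_pos x).le

lemma cdf_nonneg (z : ℝ) : 0 ≤ stdNormalCDF z := by
  rw [cdf_eq]; exact setIntegral_nonneg measurableSet_Iic fun x _ => (gp_pos x).le

lemma gQ_le_one (z : ℝ) : gQ z ≤ 1 := by have := cdf_nonneg z; unfold gQ; linarith
lemma cdf_le_one (z : ℝ) : stdNormalCDF z ≤ 1 := by have := gQ_nonneg z; unfold gQ at this; linarith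

lemma cdf_deriv (z : ℝ) : HasDerivAt stdNormalCDF (gp z) z := by
  have h : ∀ w, stdNormalCDF w = (∫ x in (0:ℝ)..w, gp x) + stdNormalCDF 0 := by
    intro w
    have := intervalIntegral.integral_Iic_sub_Iic (μ := volume) (f := gp) (a := 0) (b := w)
      gp_int.integrableOn gp_int.integrableOn
    rw [← this, cdf_eq, cdf_eq]; ring
  rw [funext h]
  exact (intervalIntegral.integral_hasDerivAt_right (gp_cont.intervalIntegrable _ _)
    (gp_cont.stronglyMeasurableAtFilter _ _) gp_cont.continuousAt).add_const _

lemma gQ_deriv (z : ℝ) : HasDerivAt gQ (-gp z) z := by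
  have h : HasDerivAt (fun x => 1 - stdNormalCDF x) (-gp z) z := (cdf_deriv z).const_sub 1
  exact h

lemma gp_deriv (z : ℝ) : HasDerivAt gp (-z * gp z) z := by
  have h1 : HasDerivAt (fun x : ℝ => -x^2/2) (-z) z := by
    exact (((hasDerivAt_pow 2 z).fun_neg).div_const 2).congr_deriv (by norm_num; ring)
  have h2 := ((h1.exp).div_const (Real.sqrt (2 * Real.pi))).congr_deriv (g' := -z * gp z) (by unfold gp; ring)
  exact h2

lemma gp_tendsto : Filter.Tendsto gp Filter.atTop (nhds 0) := by
  have h : Filter.Tendsto (fun x : ℝ => -x^2/2) Filter.atTop Filter.atBot := by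
    have h2 : Filter.Tendsto (fun x : ℝ => x^2) Filter.atTop Filter.atTop :=
      Filter.tendsto_pow_atTop (by norm_num)
    have := (Filter.tendsto_neg_atTop_atBot.comp (h2.atTop_div_const (r := 2) (by norm_num)))
    refine this.congr fun x => ?_
    simp; ring
  have := (Real.tendsto_exp_atBot.comp h).div_const (Real.sqrt (2 * Real.pi))
  rw [zero_div] at this
  exact this

lemma mills_upper (w : ℝ) : w * gQ w ≤ gp w := by
  have hi : Integrable (fun x => x * gp x) := by
    have := (integrable_mul_exp_neg_mul_sq (b := 1/2) (by norm_num)).div_const (Real.sqrt (2 * Real.pi))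
    refine this.congr (Filter.Eventually.of_forall fun x => ?_)
    simp only [gp]; rw [mul_div_assoc]; congr 3; ring
  have h1 : ∫ x in Set.Ioi w, x * gp x = gp w := by
    have := integral_Ioi_of_hasDerivAt_of_tendsto' (a := w) (f := fun x => - gp x) (f' := fun x => x * gp x) (m := 0)
      (fun x _ => by simpa using (gp_deriv x).fun_neg) hi.integrableOn (by simpa using gp_tendsto.neg)
    simpa using this
  rw [← h1, gQ_eq, ← integral_const_mul]
  refine setIntegral_mono_on (gp_int.integrableOn.const_mul _) hi.integrableOn measurableSet_Ioi ?_
  intro x hx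
  exact mul_le_mul_of_nonneg_right (le_of_lt hx) (gp_pos x).le

lemma gQ_tendsto : Filter.Tendsto gQ Filter.atTop (nhds 0) := by
  refine squeeze_zero' (Filter.Eventually.of_forall gQ_nonneg) ?_ gp_tendsto
  filter_upwards [Filter.eventually_ge_atTop 1] with x hx
  have := mills_upper x
  nlinarith [gQ_nonneg x]

lemma mills_lower (v : ℝ) : v * gp v ≤ (1 + v^2) * gQ v := by
  let g : ℝ → ℝ := fun v => gQ v - v / (1+v^2) * gp v
  have hd : ∀ v, HasDerivAt g (-gp v - (((1 * (1+v^2) - v * (2*v)) / (1+v^2)^2) * gp v + v/(1+v^2) * (-v * gp v))) v := by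
    intro v
    have hne : (1+v^2) ≠ 0 := by positivity
    have h1 : HasDerivAt (fun v : ℝ => 1 + v^2) (2*v) v := by
      simpa using (hasDerivAt_pow 2 v).const_add 1
    exact (gQ_deriv v).sub (((hasDerivAt_id v).div h1 hne).mul (gp_deriv v))
  have hanti : Antitone g := by
    refine antitone_of_deriv_nonpos (fun x => (hd x).differentiableAt) fun x => ?_
    rw [(hd x).deriv]
    have : (-gp x - (((1 * (1+x^2) - x * (2*x)) / (1+x^2)^2) * gp x + x/(1+x^2) * (-x * gp x))) = - (2 * gp x / (1+x^2)^2) := by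
      field_simp; ring
    rw [this]
    have := gp_pos x
    simp only [neg_nonpos]; positivity
  have hlim : Filter.Tendsto g Filter.atTop (nhds 0) := by
    have h2 : Filter.Tendsto (fun v : ℝ => v / (1+v^2) * gp v) Filter.atTop (nhds 0) := by
      refine squeeze_zero' ?_ ?_ gp_tendsto
      · filter_upwards [Filter.eventually_ge_atTop 0] with x hx
        have := gp_pos x; positivity
      · filter_upwards [Filter.eventually_ge_atTop 0] with x hx
        have := gp_pos x
        have h3 : x / (1+x^2) ≤ 1 := by rw [div_le_one (by positivity)]; nlinarith [sq_nonneg (x-1)]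
        nlinarith
    simpa using gQ_tendsto.sub h2
  have h0 : 0 ≤ g v := hanti.le_of_tendsto hlim v
  have hp : 0 < 1 + v^2 := by positivity
  have : (1+v^2) * g v = (1+v^2) * gQ v - v * gp v := by simp only [g]; field_simp
  nlinarith [mul_nonneg hp.le h0]

lemma gQ_pos (z : ℝ) : 0 < gQ z := by
  have hs : StrictAnti gQ := strictAnti_of_deriv_neg (fun x => by
    rw [(gQ_deriv x).deriv]; linarith [gp_pos x])
  exact lt_of_le_of_lt (gQ_nonneg (z+1)) (hs (by linarith))

/-- Mills ratio -/
noncomputable def mR (w : ℝ) : ℝ := gQ w / gp w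

lemma mR_nonneg (w : ℝ) : 0 ≤ mR w := div_nonneg (gQ_nonneg w) (gp_pos w).le

lemma mR_deriv (w : ℝ) : HasDerivAt mR (w * mR w - 1) w := by
  have := (gQ_deriv w).div (gp_deriv w) (gp_pos w).ne'
  refine this.congr_deriv ?_
  unfold mR
  have := (gp_pos w).ne'
  field_simp
  ring

lemma mR_upper (w : ℝ) : w * mR w ≤ 1 := by
  unfold mR; rw [← mul_div_assoc, div_le_one (gp_pos w)]; exact mills_upper w

lemma mR_lower (w : ℝ) : w ≤ (1 + w^2) * mR w := by
  unfold mR; rw [← mul_div_assoc, le_div_iff₀ (gp_pos w)]; exact mills_lower w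

lemma mR_le (w : ℝ) : mR w ≤ 3 * Real.exp (w^2/2) := by
  unfold mR
  rw [div_le_iff₀ (gp_pos w)]
  unfold gp
  have h3 : Real.sqrt (2 * Real.pi) ≤ 3 := by
    rw [Real.sqrt_le_left (by norm_num)]; nlinarith [Real.pi_lt_d2]
  have : 3 * Real.exp (w^2/2) * (Real.exp (-w^2/2) / Real.sqrt (2 * Real.pi)) = 3 / Real.sqrt (2*Real.pi) := by
    rw [show -w^2/2 = -(w^2/2) by ring, Real.exp_neg]
    field_simp
  rw [this, le_div_iff₀ (by positivity)]
  nlinarith [gQ_le_one w, gQ_nonneg w, Real.sqrt_nonneg (2*Real.pi)]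

/-- `exp(-z²/2) ≤ c (1+z) Q(z)`. -/
lemma exp_le_gQ : ∃ c : ℝ, 0 < c ∧ ∀ z : ℝ, 0 ≤ z → Real.exp (-z^2/2) ≤ c * (1+z) * gQ z := by
  -- for z ≥ 1 from Mills, for z ≤ 1 by monotonicity
  have hanti : Antitone gQ := antitone_of_deriv_nonpos (fun x => (gQ_deriv x).differentiableAt) fun x => by
    rw [(gQ_deriv x).deriv]; linarith [gp_pos x]
  have hq1 := gQ_pos 1
  refine ⟨1 / gQ 1 + 6, by positivity, fun z hz => ?_⟩
  have hqz := gQ_pos z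
  rcases le_total z 1 with h | h
  · have h1 : gQ 1 ≤ gQ z := hanti h
    have h2 : Real.exp (-z^2/2) ≤ 1 := by rw [Real.exp_le_one_iff]; nlinarith
    have h3 : 1 ≤ 1 / gQ 1 * gQ z := by
      rw [div_mul_eq_mul_div, one_mul, le_div_iff₀ hq1]; linarith
    have h4 : 1 / gQ 1 * gQ z ≤ (1 / gQ 1 + 6) * (1+z) * gQ z := by
      apply mul_le_mul_of_nonneg_right _ hqz.le
      have : 0 < 1 / gQ 1 := by positivity
      nlinarith
    linarith
  · have h1 := mills_lower z
    have h3 : Real.sqrt (2 * Real.pi) ≤ 3 := by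
      rw [Real.sqrt_le_left (by norm_num)]; nlinarith [Real.pi_lt_d2]
    have h4 : Real.exp (-z^2/2) ≤ 3 * gp z := by
      unfold gp
      rw [← mul_div_assoc, le_div_iff₀ (by positivity)]
      have := Real.exp_pos (-z^2/2)
      nlinarith
    have h5 : gp z ≤ 2 * (1+z) * gQ z := by
      have h6 : z * gp z ≤ z * (2 * (1+z) * gQ z) := by nlinarith
      exact le_of_mul_le_mul_left h6 (by linarith)
    have h7 : 6 * (1+z) * gQ z ≤ (1 / gQ 1 + 6) * (1+z) * gQ z := by
      apply mul_le_mul_of_nonneg_right _ hqz.le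
      have : 0 < 1 / gQ 1 := by positivity
      nlinarith
    linarith


lemma gp_neg (w : ℝ) : gp (-w) = gp w := by unfold gp; simp

lemma gQ_neg (w : ℝ) : gQ (-w) = stdNormalCDF w := by rw [← cdf_neg, neg_neg]

/-- Stein solution, left and right branches. -/
noncomputable def fA (z w : ℝ) : ℝ := mR (-w) * gQ z
noncomputable def fB (z w : ℝ) : ℝ := mR w * stdNormalCDF z
noncomputable def fS (z w : ℝ) : ℝ := if w ≤ z then fA z w else fB z w
noncomputable def hJ (z w : ℝ) : ℝ := if w ≤ z then 0 else 1

lemma fA_eq_fB (z : ℝ) : fA z z = fB z z := by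
  unfold fA fB mR; rw [gQ_neg, gp_neg]; ring

lemma fA_deriv (z w : ℝ) : HasDerivAt (fA z) (w * fA z w + gQ z) w := by
  have h : HasDerivAt (fun w => mR (-w)) (w * mR (-w) + 1) w := by
    refine ((mR_deriv (-w)).comp w (hasDerivAt_neg w)).congr_deriv ?_
    ring
  refine (h.mul_const (gQ z)).congr_deriv ?_
  unfold fA; ring

lemma fB_deriv (z w : ℝ) : HasDerivAt (fB z) (w * fB z w - stdNormalCDF z) w := by
  refine ((mR_deriv w).mul_const (stdNormalCDF z)).congr_deriv ?_
  unfold fB; ring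

lemma fA_mono (z : ℝ) : Monotone (fun w => w * fA z w) := by
  have hd : ∀ w, HasDerivAt (fun w => w * fA z w) (1 * fA z w + w * (w * fA z w + gQ z)) w :=
    fun w => (hasDerivAt_id w).mul (fA_deriv z w)
  refine monotone_of_deriv_nonneg (fun x => (hd x).differentiableAt) fun x => ?_
  rw [(hd x).deriv]
  have := mR_lower (-x)
  unfold fA
  nlinarith [gQ_nonneg z]

lemma fB_mono (z : ℝ) : Monotone (fun w => w * fB z w) := by
  have hd : ∀ w, HasDerivAt (fun w => w * fB z w) (1 * fB z w + w * (w * fB z w - stdNormalCDF z)) w :=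
    fun w => (hasDerivAt_id w).mul (fB_deriv z w)
  refine monotone_of_deriv_nonneg (fun x => (hd x).differentiableAt) fun x => ?_
  rw [(hd x).deriv]
  have := mR_lower x
  unfold fB
  nlinarith [cdf_nonneg z]

lemma mvt_bounds (g g' : ℝ → ℝ) (hg : ∀ w, HasDerivAt g (g' w) w) (hm : Monotone g') {x y : ℝ} (hxy : x ≤ y) :
    (y - x) * g' x ≤ g y - g x ∧ g y - g x ≤ (y - x) * g' y := by
  rcases hxy.eq_or_lt with rfl | h
  · simp
  obtain ⟨c, hc, h2⟩ := exists_hasDerivAt_eq_slope g g' h (fun w _ => (hg w).continuousAt.continuousWithinAt) (fun w _ => hg w)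
  have hp : 0 < y - x := by linarith
  rw [eq_div_iff hp.ne'] at h2
  have h3 := hm hc.1.le
  have h4 := hm hc.2.le
  constructor <;> nlinarith

lemma fA_mvt (z : ℝ) {x y : ℝ} (hxy : x ≤ y) :
    (y - x) * (x * fA z x + gQ z) ≤ fA z y - fA z x ∧ fA z y - fA z x ≤ (y - x) * (y * fA z y + gQ z) :=
  mvt_bounds (fA z) (fun w => w * fA z w + gQ z) (fA_deriv z) ((fA_mono z).add_const _) hxy

lemma fB_mvt (z : ℝ) {x y : ℝ} (hxy : x ≤ y) :
    (y - x) * (x * fB z x - stdNormalCDF z) ≤ fB z y - fB z x ∧ fB z y - fB z x ≤ (y - x) * (y * fB z y - stdNormalCDF z) :=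
  mvt_bounds (fB z) (fun w => w * fB z w - stdNormalCDF z) (fB_deriv z)
    (by simpa [sub_eq_add_neg] using (fB_mono z).add_const (-stdNormalCDF z)) hxy

lemma fS_mono (z : ℝ) : Monotone (fun w => w * fS z w) := by
  intro x y hxy
  simp only [fS]
  split_ifs with h1 h2 h2
  · exact fA_mono z hxy
  · have a1 := fA_mono z h1
    have a2 := fB_mono z (not_le.mp h2).le
    simp only at a1 a2
    rw [fA_eq_fB] at a1; linarith
  · exact absurd (hxy.trans h2) h1
  · exact fB_mono z hxy

lemma hJ_mono (z : ℝ) : Monotone (hJ z) := by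
  intro x y hxy
  simp only [hJ]
  split_ifs with h1 h2 h2
  · norm_num
  · norm_num
  · exact absurd (hxy.trans h2) h1
  · norm_num

lemma fS_mvt (z : ℝ) {x y : ℝ} (hxy : x ≤ y) :
    (y - x) * (x * fS z x - hJ z y + gQ z) ≤ fS z y - fS z x ∧
    fS z y - fS z x ≤ (y - x) * (y * fS z y - hJ z x + gQ z) := by
  have hc : stdNormalCDF z = 1 - gQ z := by unfold gQ; ring
  simp only [fS, hJ]
  split_ifs with h1 h2 h2
  · simpa using fA_mvt z hxy
  · have a1 := fA_mvt z h1
    have a2 := fB_mvt z (not_le.mp h2).le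
    have m1 := fA_mono z h1
    have m2 := fB_mono z (not_le.mp h2).le
    simp only at m1 m2
    rw [fA_eq_fB] at a1 m1
    rw [hc] at a2
    have p1 : 0 ≤ z - x := by linarith
    have p2 : 0 ≤ y - z := by linarith [not_le.mp h2]
    constructor <;> nlinarith [mul_nonneg p1 (sub_nonneg.2 m1), mul_nonneg p2 (sub_nonneg.2 m2), mul_nonneg p1 (sub_nonneg.2 m2), mul_nonneg p2 (sub_nonneg.2 m1)]
  · exact absurd (hxy.trans h2) h1
  · have a2 := fB_mvt z hxy
    rw [hc] at a2
    constructor <;> nlinarith [a2.1, a2.2]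

/-- derivative of the Stein solution -/
noncomputable def fD (z w : ℝ) : ℝ := w * fS z w - hJ z w + gQ z
noncomputable def fH (z w : ℝ) : ℝ := w * fS z w + hJ z w

lemma fS_incr (z a b : ℝ) :
    |fS z a - fS z b - (a - b) * fD z a| ≤ (a - b) * (fH z a - fH z b) := by
  unfold fD fH
  rcases le_total b a with h | h
  · have := fS_mvt z h
    have m1 := fS_mono z h
    have m2 := hJ_mono z h
    simp only at m1
    have p : 0 ≤ a - b := by linarith
    rw [abs_le]
    constructor <;> nlinarith [mul_nonneg p (sub_nonneg.2 m1), mul_nonneg p (sub_nonneg.2 m2)]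
  · have := fS_mvt z h
    have m1 := fS_mono z h
    have m2 := hJ_mono z h
    simp only at m1
    have p : 0 ≤ b - a := by linarith
    rw [abs_le]
    constructor <;> nlinarith [mul_nonneg p (sub_nonneg.2 m1), mul_nonneg p (sub_nonneg.2 m2)]

/-- size bound function -/
noncomputable def fM (z w : ℝ) : ℝ :=
  gQ z * (1 + 3 * (if 0 ≤ w ∧ w ≤ z then w * Real.exp (w^2/2) else 0)) + 2 * hJ z w

lemma fA_bound (z w : ℝ) (h : w ≤ z) :
    |w * fA z w| ≤ gQ z * (1 + 3 * (if 0 ≤ w ∧ w ≤ z then w * Real.exp (w^2/2) else 0)) ∧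
    |w * fA z w + gQ z| ≤ gQ z * (1 + 3 * (if 0 ≤ w ∧ w ≤ z then w * Real.exp (w^2/2) else 0)) := by
  have hq := gQ_nonneg z
  have hr := mR_nonneg (-w)
  unfold fA
  by_cases hw : 0 ≤ w
  · rw [if_pos ⟨hw, h⟩]
    have h1 := mR_le (-w)
    rw [neg_sq] at h1
    have h2 : w * mR (-w) ≤ w * (3 * Real.exp (w^2/2)) := mul_le_mul_of_nonneg_left h1 hw
    have h3 : w * (mR (-w) * gQ z) ≤ gQ z * (3 * (w * Real.exp (w^2/2))) := by nlinarith
    have h0 : 0 ≤ w * (mR (-w) * gQ z) := by positivity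
    rw [abs_of_nonneg h0, abs_of_nonneg (by positivity)]
    constructor <;> nlinarith
  · rw [if_neg (fun h => hw h.1)]
    have h1 := mR_upper (-w)
    have h2 : w * mR (-w) ≤ 0 := by nlinarith
    have h3 : w * (mR (-w) * gQ z) = (w * mR (-w)) * gQ z := by ring
    rw [h3, abs_le, abs_le]
    refine ⟨⟨?_, ?_⟩, ?_, ?_⟩ <;> nlinarith

lemma fB_bound (z w : ℝ) (h : z < w) (hz : 0 ≤ z) :
    |w * fB z w| ≤ 1 ∧ |w * fB z w - 1 + gQ z| ≤ 1 := by
  have hr := mR_nonneg w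
  have h1 := mR_upper w
  have hc := cdf_nonneg z
  have hc1 := cdf_le_one z
  have hq : gQ z = 1 - stdNormalCDF z := rfl
  unfold fB
  have h2 : 0 ≤ w * mR w := mul_nonneg (by linarith) hr
  have h3 : w * (mR w * stdNormalCDF z) = (w * mR w) * stdNormalCDF z := by ring
  rw [h3, hq, abs_le, abs_le]
  refine ⟨⟨?_, ?_⟩, ?_, ?_⟩ <;> nlinarith

lemma fD_bound (z w : ℝ) (hz : 0 ≤ z) : |fD z w| ≤ fM z w := by
  unfold fD fM fS hJ
  split_ifs with h h1 h1
  · have := (fA_bound z w h).2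
    rw [if_pos h1] at this; simpa using this
  · have := (fA_bound z w h).2
    rw [if_neg h1] at this; simpa using this
  · exact absurd h1.2 h
  · have := (fB_bound z w (not_le.mp h) hz).2
    have := gQ_nonneg z
    linarith

lemma fH_bound (z w : ℝ) (hz : 0 ≤ z) : |fH z w| ≤ fM z w := by
  unfold fH fM fS hJ
  split_ifs with h h1 h1
  · have := (fA_bound z w h).1
    rw [if_pos h1] at this; simpa using this
  · have := (fA_bound z w h).1
    rw [if_neg h1] at this; simpa using this
  · exact absurd h1.2 h
  · have h1 := (fB_bound z w (not_le.mp h) hz).1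
    have h2 := gQ_nonneg z
    have h3 := abs_add_le (w * fB z w) 1
    rw [abs_one] at h3
    linarith

/-- domination of `e^{w²/2}` on `[0,z]` by exponential tilts. -/
lemma exp_sq_le (z w : ℝ) (h0 : 0 ≤ w) (h1 : w ≤ z) :
    Real.exp (w^2/2) ≤ 2 * ∑ j ∈ Finset.range (⌊z⌋₊ + 1), Real.exp (-(j:ℝ)^2/2) * Real.exp (j * w) := by
  have hj : ⌊w⌋₊ ∈ Finset.range (⌊z⌋₊ + 1) := by
    rw [Finset.mem_range, Nat.lt_succ_iff]; exact Nat.floor_le_floor h1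
  have h2 := Finset.single_le_sum (f := fun j : ℕ => Real.exp (-(j:ℝ)^2/2) * Real.exp (j * w))
    (fun i _ => by positivity) hj
  refine le_trans ?_ (mul_le_mul_of_nonneg_left h2 (by norm_num))
  have hl := Nat.floor_le h0
  have hu := (Nat.lt_floor_add_one w).le
  set j : ℝ := (⌊w⌋₊ : ℝ)
  have e2 : Real.exp (1/2) ≤ 2 := by
    have h3 : Real.exp (1/2) ^ 2 = Real.exp 1 := by rw [← Real.exp_nat_mul]; norm_num
    have h4 := Real.exp_one_lt_d9
    nlinarith [Real.exp_pos (1/2 : ℝ)]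
  rw [← Real.exp_add]
  calc Real.exp (w^2/2) ≤ Real.exp (1/2 + (-j^2/2 + j*w)) := by
        apply Real.exp_le_exp.2; nlinarith
    _ = Real.exp (1/2) * Real.exp (-j^2/2 + j*w) := Real.exp_add _ _
    _ ≤ _ := mul_le_mul_of_nonneg_right e2 (Real.exp_pos _).le


/-- uniform average -/
noncomputable def ex {S : Type} [Fintype S] (g : S → ℝ) : ℝ := (∑ s, g s) / (Fintype.card S : ℝ)

section ex
variable {S : Type} [Fintype S]

lemma ex_add (g h : S → ℝ) : ex (fun s => g s + h s) = ex g + ex h := by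
  simp only [ex, Finset.sum_add_distrib, add_div]
lemma ex_sub (g h : S → ℝ) : ex (fun s => g s - h s) = ex g - ex h := by
  simp only [ex, Finset.sum_sub_distrib, sub_div]
lemma ex_mul_left (c : ℝ) (g : S → ℝ) : ex (fun s => c * g s) = c * ex g := by
  simp only [ex, ← Finset.mul_sum, mul_div_assoc]
lemma ex_sum {ι : Type*} (W : Finset ι) (g : ι → S → ℝ) :
    ex (fun s => ∑ k ∈ W, g k s) = ∑ k ∈ W, ex (g k) := by
  simp only [ex, ← Finset.sum_div]
  rw [Finset.sum_comm]
lemma ex_mono {g h : S → ℝ} (H : ∀ s, g s ≤ h s) : ex g ≤ ex h := by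
  unfold ex
  exact div_le_div_of_nonneg_right (Finset.sum_le_sum fun s _ => H s) (Nat.cast_nonneg _)
lemma ex_nonneg {g : S → ℝ} (H : ∀ s, 0 ≤ g s) : 0 ≤ ex g :=
  div_nonneg (Finset.sum_nonneg fun s _ => H s) (Nat.cast_nonneg _)
lemma ex_abs_le (g : S → ℝ) : |ex g| ≤ ex (fun s => |g s|) := by
  unfold ex
  rw [abs_div, Nat.abs_cast]
  exact div_le_div_of_nonneg_right (Finset.abs_sum_le_sum_abs _ _) (Nat.cast_nonneg _)
lemma ex_const [Nonempty S] (c : ℝ) : ex (fun _ : S => c) = c := by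
  simp [ex]
lemma ex_flip {φ : S → S} (h : Function.Involutive φ) (g : S → ℝ) : ex (fun s => g (φ s)) = ex g := by
  unfold ex
  congr 1
  exact Equiv.sum_comp h.toPerm g
lemma ex_odd {φ : S → S} (h : Function.Involutive φ) (g v : S → ℝ) (hv : ∀ s, v (φ s) = - v s) :
    ex (fun s => g s * v s) = 1/2 * ex (fun s => (g s - g (φ s)) * v s) := by
  have h1 : ex (fun s => g (φ s) * v s) = - ex (fun s => g s * v s) := by
    rw [← ex_flip h (fun s => g s * v s)]
    have : (fun s => g (φ s) * v s) = fun s => (-1) * (g (φ s) * v (φ s)) := by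
      funext s; rw [hv]; ring
    rw [this, ex_mul_left]; ring
  have h2 : (fun s => (g s - g (φ s)) * v s) = fun s => g s * v s - g (φ s) * v s := by
    funext s; ring
  rw [h2, ex_sub, h1]; ring
lemma ex_cs (e V : S → ℝ) (he : ∀ s, 0 ≤ e s) (B : ℝ) (hB : 0 ≤ B)
    (h : ex (fun s => e s * V s ^ 2) ≤ B^2 * ex e) : ex (fun s => e s * |V s|) ≤ B * ex e := by
  rcases hB.eq_or_lt with h0 | h0
  · subst h0
    have h1 : ex (fun s => e s * V s ^ 2) = 0 := le_antisymm (by simpa using h) (ex_nonneg fun s => mul_nonneg (he s) (sq_nonneg _))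
    have h2 : ∀ t : ℝ, 0 < t → ex (fun s => e s * |V s|) ≤ t * ex e := by
      intro t ht
      have h3 : ex (fun s => e s * |V s|) ≤ ex (fun s => (1 / (4 * t)) * (e s * V s ^ 2) + t * e s) := by
        refine ex_mono fun s => ?_
        have h4 : |V s| ≤ (1/(4*t)) * V s ^2 + t := by
          rw [← sq_abs]
          have : (1/(4*t)) * |V s| ^2 + t - |V s| = (|V s| - 2 * t)^2 / (4*t) := by field_simp; ring
          have h5 : 0 ≤ (|V s| - 2 * t)^2 / (4*t) := by positivity
          linarith
        nlinarith [mul_le_mul_of_nonneg_left h4 (he s)]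
      rw [ex_add, ex_mul_left, ex_mul_left, h1] at h3
      linarith
    have h6 : 0 ≤ ex e := ex_nonneg he
    refine le_of_forall_pos_le_add fun ε hε => ?_
    have h7 := h2 (ε / (ex e + 1)) (by positivity)
    have h8 : ε / (ex e + 1) * ex e ≤ ε := by
      rw [div_mul_eq_mul_div, div_le_iff₀ (by positivity)]; nlinarith
    linarith
  · have h3 : ex (fun s => e s * |V s|) ≤ ex (fun s => (1 / (2 * B)) * (e s * V s ^ 2) + (B/2) * e s) := by
      refine ex_mono fun s => ?_
      have h4 : |V s| ≤ (1/(2*B)) * V s ^2 + B/2 := by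
        rw [← sq_abs]
        have : (1/(2*B)) * |V s| ^2 + B/2 - |V s| = (|V s| - B)^2 / (2*B) := by field_simp; ring
        have h5 : 0 ≤ (|V s| - B)^2 / (2*B) := by positivity
        linarith
      nlinarith [mul_le_mul_of_nonneg_left h4 (he s)]
    rw [ex_add, ex_mul_left, ex_mul_left] at h3
    have h6 : 1/(2*B) * ex (fun s => e s * V s ^ 2) ≤ 1/(2*B) * (B^2 * ex e) :=
      mul_le_mul_of_nonneg_left h (by positivity)
    have h7 : 1/(2*B) * (B^2 * ex e) = B/2 * ex e := by field_simp
    linarith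
end ex

lemma abs_exp_sub_one (t : ℝ) : |Real.exp t - 1| ≤ |t| * Real.exp |t| := by
  have h1 := Real.add_one_le_exp t
  have h2 : Real.exp t - 1 ≤ t * Real.exp t := by
    have := Real.add_one_le_exp (-t)
    have h3 : Real.exp (-t) * Real.exp t = 1 := by rw [← Real.exp_add]; simp
    nlinarith [Real.exp_pos t]
  have h3 : 1 ≤ Real.exp |t| := Real.one_le_exp (abs_nonneg t)
  have h4 : Real.exp t ≤ Real.exp |t| := Real.exp_le_exp.2 (le_abs_self t)
  rw [abs_le]
  constructor
  · nlinarith [neg_abs_le t, abs_nonneg t]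
  · nlinarith [le_abs_self t, abs_nonneg t, Real.exp_pos t]

lemma abs_exp_sub_two (t : ℝ) : |Real.exp t - 1 - t| ≤ t^2 * Real.exp |t| := by
  have h1 := Real.add_one_le_exp t
  have h2 : Real.exp t - 1 ≤ t * Real.exp t := by
    have := Real.add_one_le_exp (-t)
    have h3 : Real.exp (-t) * Real.exp t = 1 := by rw [← Real.exp_add]; simp
    nlinarith [Real.exp_pos t]
  have h3 := abs_exp_sub_one t
  rw [abs_of_nonneg (by linarith)]
  have h4 : t * (Real.exp t - 1) ≤ |t| * |Real.exp t - 1| := by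
    rw [← abs_mul]; exact le_abs_self _
  have h5 : |t| * |Real.exp t - 1| ≤ |t| * (|t| * Real.exp |t|) := mul_le_mul_of_nonneg_left h3 (abs_nonneg t)
  have h6 : |t| * (|t| * Real.exp |t|) = t^2 * Real.exp |t| := by rw [← sq_abs]; ring
  linarith

structure RW (S : Type) where
  W : Finset ℤ
  x : ℤ → S → ℝ
  φ : ℤ → S → S
  b : ℤ → ℝ
  hx : ∀ k s, x k s = 1 ∨ x k s = -1
  hinv : ∀ k, Function.Involutive (φ k)
  hflip : ∀ k ∈ W, ∀ s, x k (φ k s) = - x k s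
  hoth : ∀ j k s, j ≠ k → x j (φ k s) = x j s
  hb1 : ∀ i, i ∉ W → b i = 0
  hb2 : ∀ i, i + 1 ∉ W → b i = 0

namespace RW
variable {S : Type} (R : RW S)

noncomputable def F (s : S) : ℝ := ∑ i ∈ R.W, R.b i / 4 * (R.x i s + R.x (i+1) s + R.x i s * R.x (i+1) s)
noncomputable def Q (k : ℤ) (s : S) : ℝ := 1/2 * (R.b (k-1) * (1 + R.x (k-1) s) + R.b k * (1 + R.x (k+1) s))
noncomputable def P (k : ℤ) (s : S) : ℝ := 1/2 * (R.b (k-1) * (1 + R.x (k-1) s / 2) + R.b k * (1 + R.x (k+1) s / 2))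
noncomputable def D (k : ℤ) : ℝ := |R.b (k-2)| + |R.b (k-1)| + |R.b k| + |R.b (k+1)|
noncomputable def T (s : S) : ℝ := ∑ k ∈ R.W, 1/4 * (R.P k s * R.Q k s)

lemma D_nonneg (k : ℤ) : 0 ≤ R.D k := by unfold D; positivity

lemma x_sq (k : ℤ) (s : S) : R.x k s * R.x k s = 1 := by
  rcases R.hx k s with h | h <;> rw [h] <;> norm_num
lemma x_abs (k : ℤ) (s : S) : |R.x k s| = 1 := by
  rcases R.hx k s with h | h <;> rw [h] <;> norm_num

lemma shift_sum (f : ℤ → ℝ) (h1 : ∀ i, i ∉ R.W → f i = 0) (h2 : ∀ i, i + 1 ∉ R.W → f i = 0) :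
    ∑ k ∈ R.W, f (k-1) = ∑ k ∈ R.W, f k := by
  refine Finset.sum_bij_ne_zero (fun k _ _ => k - 1) ?_ ?_ ?_ ?_
  · intro k _ hk
    by_contra h
    exact hk (h1 _ h)
  · intro a _ _ b _ _ h
    linarith
  · intro k hk hf
    refine ⟨k+1, ?_, ?_, by ring⟩
    · by_contra h
      exact hf (h2 _ h)
    · simpa using hf
  · intro k _ _; rfl

lemma F_eq (s : S) : R.F s = ∑ k ∈ R.W, 1/2 * (R.x k s * R.P k s) := by
  have h := R.shift_sum (fun i => R.b i / 4 * (R.x (i+1) s * (1 + R.x i s / 2)))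
    (fun i hi => by simp [R.hb1 i hi]) (fun i hi => by simp [R.hb2 i hi])
  have h1 : ∀ k, 1/2 * (R.x k s * R.P k s) =
      R.b (k-1) / 4 * (R.x (k-1+1) s * (1 + R.x (k-1) s / 2)) + R.b k / 4 * (R.x k s * (1 + R.x (k+1) s / 2)) := by
    intro k; unfold P; rw [sub_add_cancel]; ring
  simp only [h1]
  rw [Finset.sum_add_distrib, h, ← Finset.sum_add_distrib]
  unfold F
  refine Finset.sum_congr rfl fun i _ => ?_
  ring

lemma F_flip (k : ℤ) (hk : k ∈ R.W) (s : S) : R.F (R.φ k s) = R.F s - R.x k s * R.Q k s := by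
  have h : ∀ i ∈ R.W, R.b i / 4 * (R.x i (R.φ k s) + R.x (i+1) (R.φ k s) + R.x i (R.φ k s) * R.x (i+1) (R.φ k s))
      = R.b i / 4 * (R.x i s + R.x (i+1) s + R.x i s * R.x (i+1) s)
        - ((if i = k - 1 then R.x k s * (1/2 * (R.b (k-1) * (1 + R.x (k-1) s))) else 0)
          + (if i = k then R.x k s * (1/2 * (R.b k * (1 + R.x (k+1) s))) else 0)) := by
    intro i _
    by_cases h1 : i = k
    · subst h1
      rw [if_neg (by omega), if_pos rfl, R.hflip i hk, R.hoth (i+1) i s (by omega)]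
      ring
    · by_cases h2 : i = k - 1
      · subst h2
        rw [if_pos rfl, if_neg h1, sub_add_cancel, R.hflip k hk, R.hoth (k-1) k s (by omega)]
        ring
      · rw [if_neg h2, if_neg h1, R.hoth i k s h1, R.hoth (i+1) k s (by omega)]
        ring
  unfold F
  rw [Finset.sum_congr rfl h, Finset.sum_sub_distrib, Finset.sum_add_distrib, Finset.sum_ite_eq', Finset.sum_ite_eq', if_pos hk]
  congr 1
  unfold Q
  split_ifs with h3
  · ring
  · rw [R.hb1 _ h3]; ring

lemma exp_flip (y : ℝ) (k : ℤ) (hk : k ∈ R.W) (s : S) : Real.exp (y * R.F (R.φ k s)) =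
    Real.exp (y * R.F s) * Real.exp (-(y * (R.x k s * R.Q k s))) := by
  rw [R.F_flip k hk, ← Real.exp_add]; congr 1; ring

lemma Q_inv (j k : ℤ) (s : S) (h1 : j ≠ k - 1) (h2 : j ≠ k + 1) : R.Q k (R.φ j s) = R.Q k s := by
  unfold Q; rw [R.hoth _ _ _ h1.symm, R.hoth _ _ _ h2.symm]
lemma P_inv (j k : ℤ) (s : S) (h1 : j ≠ k - 1) (h2 : j ≠ k + 1) : R.P k (R.φ j s) = R.P k s := by
  unfold P; rw [R.hoth _ _ _ h1.symm, R.hoth _ _ _ h2.symm]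

lemma Q_abs (k : ℤ) (s : S) : |R.Q k s| ≤ |R.b (k-1)| + |R.b k| := by
  unfold Q
  have h : ∀ c : ℝ, ∀ j, |c * (1 + R.x j s)| ≤ 2 * |c| := by
    intro c j
    rw [abs_mul]
    rcases R.hx j s with h | h <;> rw [h] <;> norm_num
    linarith
  rw [abs_mul]
  have := abs_add_le (R.b (k-1) * (1 + R.x (k-1) s)) (R.b k * (1 + R.x (k+1) s))
  have h1 := h (R.b (k-1)) (k-1)
  have h2 := h (R.b k) (k+1)
  norm_num at *
  linarith

lemma P_abs (k : ℤ) (s : S) : |R.P k s| ≤ |R.b (k-1)| + |R.b k| := by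
  unfold P
  have h : ∀ c : ℝ, ∀ j, |c * (1 + R.x j s / 2)| ≤ 2 * |c| := by
    intro c j
    rw [abs_mul]
    rcases R.hx j s with h | h <;> rw [h] <;> norm_num [abs_of_pos] <;> linarith [abs_nonneg c]
  rw [abs_mul]
  have := abs_add_le (R.b (k-1) * (1 + R.x (k-1) s / 2)) (R.b k * (1 + R.x (k+1) s / 2))
  have h1 := h (R.b (k-1)) (k-1)
  have h2 := h (R.b k) (k+1)
  norm_num at *
  linarith

lemma Q_le_D (k e : ℤ) (he : e = 0 ∨ e = 1 ∨ e = -1) (s : S) : |R.Q (k+e) s| ≤ R.D k := by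
  refine (R.Q_abs _ s).trans ?_
  unfold D
  have := abs_nonneg (R.b (k-2)); have := abs_nonneg (R.b (k-1))
  have := abs_nonneg (R.b (k)); have := abs_nonneg (R.b (k+1))
  rcases he with rfl | rfl | rfl
  · rw [add_zero]; linarith
  · rw [add_sub_cancel_right]; linarith
  · rw [show k + -1 - 1 = k - 2 by ring, show k + -1 = k - 1 by ring]; linarith

lemma P_le_D (k : ℤ) (s : S) : |R.P k s| ≤ R.D k := by
  refine (R.P_abs _ s).trans ?_
  unfold D
  have := abs_nonneg (R.b (k-2)); have := abs_nonneg (R.b (k+1))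
  linarith

variable [Fintype S]

lemma stein (g : S → ℝ) : ex (fun s => R.F s * g s) =
    ∑ k ∈ R.W, 1/4 * ex (fun s => (g s - g (R.φ k s)) * (R.x k s * R.P k s)) := by
  have h : (fun s => R.F s * g s) = fun s => ∑ k ∈ R.W, 1/2 * (g s * (R.x k s * R.P k s)) := by
    funext s; rw [F_eq, Finset.sum_mul]; refine Finset.sum_congr rfl fun i _ => ?_; ring
  rw [h, ex_sum]
  refine Finset.sum_congr rfl fun k hk => ?_
  rw [ex_mul_left, ex_odd (R.hinv k) g (fun s => R.x k s * R.P k s)]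
  · ring
  · intro s
    rw [R.hflip k hk, R.P_inv k k s (by omega) (by omega)]; ring

/-- moment generating function -/
noncomputable def m (y : ℝ) : ℝ := ex (fun s => Real.exp (y * R.F s))

lemma m_nonneg (y : ℝ) : 0 ≤ R.m y := ex_nonneg fun s => (Real.exp_pos _).le

lemma cross (e : ℤ) (he : e = 0 ∨ e = 1 ∨ e = -1) (u : ℤ → S → ℝ)
    (hodd : ∀ k, k + e ∈ R.W → ∀ s, u k (R.φ (k+e) s) = - u k s)
    (hfar : ∀ k l s, 2 < |k - l| → u l (R.φ (k+e) s) = u l s)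
    (hbd : ∀ k s, |u k s| ≤ R.D k ^ 2) (y : ℝ) (hy : 0 ≤ y) (hyD : ∀ k, y * R.D k ≤ 6)
    (k l : ℤ) (hk : k + e ∈ R.W) (hl : l + e ∈ R.W) (hkl : 2 < |k - l|) :
    ex (fun s => Real.exp (y * R.F s) * (u k s * u l s)) ≤
      R.m y * (Real.exp 6 ^ 2 * y^2 * (R.D k ^ 3 * R.D l ^ 3)) := by
  have hlk : 2 < |l - k| := by rwa [abs_sub_comm]
  have hne : (k + e ≠ l + e - 1) ∧ (k + e ≠ l + e + 1) ∧ k + e ≠ l + e ∧ (l + e ≠ k + e - 1) ∧ (l + e ≠ k + e + 1) := by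
    rcases lt_abs.1 hkl with h | h <;> omega
  obtain ⟨n1, n2, n3, n4, n5⟩ := hne
  rw [ex_odd (R.hinv (k+e)) (fun s => Real.exp (y * R.F s)) (fun s => u k s * u l s)
    (fun s => by rw [hodd k hk, hfar k l s hkl]; ring)]
  have e1 : (fun s => (Real.exp (y * R.F s) - Real.exp (y * R.F (R.φ (k+e) s))) * (u k s * u l s))
      = fun s => (Real.exp (y * R.F s) * (1 - Real.exp (-(y * (R.x (k+e) s * R.Q (k+e) s))))) * (u k s * u l s) := by
    funext s
    rw [R.exp_flip y _ hk]; ring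
  rw [e1, ex_odd (R.hinv (l+e)) (fun s => (Real.exp (y * R.F s) * (1 - Real.exp (-(y * (R.x (k+e) s * R.Q (k+e) s)))))) (fun s => u k s * u l s)
    (fun s => by rw [hodd l hl, hfar l k s hlk]; ring)]
  have key : ex (fun s =>
          (Real.exp (y * R.F s) * (1 - Real.exp (-(y * (R.x (k + e) s * R.Q (k + e) s)))) -
              Real.exp (y * R.F (R.φ (l + e) s)) *
                (1 - Real.exp (-(y * (R.x (k + e) (R.φ (l + e) s) * R.Q (k + e) (R.φ (l + e) s)))))) *
            (u k s * u l s)) ≤ ex (fun s => (Real.exp 6 ^ 2 * y^2 * (R.D k ^ 3 * R.D l ^ 3)) * Real.exp (y * R.F s)) := by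
    refine ex_mono fun s => ?_
    rw [R.exp_flip y _ hl, R.hoth _ _ _ n3, R.Q_inv _ _ _ n4 n5]
    set E := Real.exp (y * R.F s)
    have hE : 0 < E := Real.exp_pos _
    have hb : ∀ j, |1 - Real.exp (-(y * (R.x (j + e) s * R.Q (j + e) s)))| ≤ Real.exp 6 * y * R.D j := by
      intro j
      rw [abs_sub_comm]
      refine (abs_exp_sub_one _).trans ?_
      have h1 : |-(y * (R.x (j + e) s * R.Q (j + e) s))| ≤ y * R.D j := by
        rw [abs_neg, abs_mul, abs_mul, R.x_abs, abs_of_nonneg hy, one_mul]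
        exact mul_le_mul_of_nonneg_left (R.Q_le_D j e he s) hy
      have h2 := Real.exp_le_exp.2 (h1.trans (hyD j))
      calc _ ≤ (y * R.D j) * Real.exp 6 := mul_le_mul h1 h2 (Real.exp_pos _).le (mul_nonneg hy (R.D_nonneg j))
        _ = _ := by ring
    have hk1 := hb k
    have hl1 := hb l
    set A := 1 - Real.exp (-(y * (R.x (k + e) s * R.Q (k + e) s))) with hA
    set B := 1 - Real.exp (-(y * (R.x (l + e) s * R.Q (l + e) s))) with hB
    have hB' : Real.exp (-(y * (R.x (l + e) s * R.Q (l + e) s))) = 1 - B := by rw [hB]; ring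
    rw [hB']
    have hre : (E * A - E * (1 - B) * A) * (u k s * u l s) = E * (A * B * (u k s * u l s)) := by ring
    rw [hre, mul_comm _ E]
    refine mul_le_mul_of_nonneg_left ?_ hE.le
    refine (le_abs_self _).trans ?_
    rw [abs_mul, abs_mul, abs_mul]
    have q1 := R.D_nonneg k
    have q2 := R.D_nonneg l
    calc |A| * |B| * (|u k s| * |u l s|) ≤ (Real.exp 6 * y * R.D k) * (Real.exp 6 * y * R.D l) * (R.D k ^ 2 * R.D l ^ 2) := by
          gcongr
          · exact hbd k s
          · exact hbd l s
      _ = _ := by ring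
  rw [ex_mul_left] at key
  have h0 : 0 ≤ (Real.exp 6 ^ 2 * y^2 * (R.D k ^ 3 * R.D l ^ 3)) * R.m y := by
    have q1 := R.D_nonneg k
    have q2 := R.D_nonneg l
    have := R.m_nonneg y
    positivity
  have : ex (fun s => Real.exp (y * R.F s)) = R.m y := rfl
  rw [this] at key
  linarith

lemma keyLemma (e : ℤ) (he : e = 0 ∨ e = 1 ∨ e = -1) (u : ℤ → S → ℝ)
    (hodd : ∀ k, k + e ∈ R.W → ∀ s, u k (R.φ (k+e) s) = - u k s)
    (hzero : ∀ k, k + e ∉ R.W → ∀ s, u k s = 0)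
    (hfar : ∀ k l s, 2 < |k - l| → u l (R.φ (k+e) s) = u l s)
    (hbd : ∀ k s, |u k s| ≤ R.D k ^ 2) (y : ℝ) (hy : 0 ≤ y) (hyD : ∀ k, y * R.D k ≤ 6) :
    ex (fun s => Real.exp (y * R.F s) * (∑ k ∈ R.W, u k s) ^ 2) ≤
      R.m y * (5 * ∑ k ∈ R.W, R.D k ^ 4 + Real.exp 6 ^ 2 * y^2 * (∑ k ∈ R.W, R.D k ^ 3)^2) := by
  have hm := R.m_nonneg y
  have hD := R.D_nonneg
  have e1 : (fun s => Real.exp (y * R.F s) * (∑ k ∈ R.W, u k s) ^ 2) =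
      fun s => ∑ k ∈ R.W, ∑ l ∈ R.W, Real.exp (y * R.F s) * (u k s * u l s) := by
    funext s
    rw [pow_two, Finset.sum_mul_sum, Finset.mul_sum]
    refine Finset.sum_congr rfl fun k _ => ?_
    rw [Finset.mul_sum]
  rw [e1, ex_sum]
  have e2 : ∀ k, ex (fun s => ∑ l ∈ R.W, Real.exp (y * R.F s) * (u k s * u l s)) =
    ∑ l ∈ R.W, ex (fun s => Real.exp (y * R.F s) * (u k s * u l s)) := fun k => ex_sum _ _
  simp only [e2]
  have hb : ∀ k l, ex (fun s => Real.exp (y * R.F s) * (u k s * u l s)) ≤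
      R.m y * ((if |k - l| ≤ 2 then (R.D k ^ 4 + R.D l ^ 4)/2 else 0) + Real.exp 6 ^ 2 * y^2 * (R.D k ^ 3 * R.D l ^ 3)) := by
    intro k l
    have p := hD k
    have q := hD l
    split_ifs with h
    · have h1 : ex (fun s => Real.exp (y * R.F s) * (u k s * u l s)) ≤ ex (fun s => ((R.D k ^ 4 + R.D l ^ 4)/2) * Real.exp (y * R.F s)) := by
        refine ex_mono fun s => ?_
        rw [mul_comm _ (Real.exp _)]
        refine mul_le_mul_of_nonneg_left ?_ (Real.exp_pos _).le
        have a1 : u k s * u l s ≤ R.D k ^ 2 * R.D l ^ 2 := by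
          refine (le_abs_self _).trans ?_
          rw [abs_mul]
          exact mul_le_mul (hbd k s) (hbd l s) (abs_nonneg _) (by positivity)
        nlinarith [sq_nonneg (R.D k ^ 2 - R.D l ^ 2)]
      rw [ex_mul_left] at h1
      have : ex (fun s => Real.exp (y * R.F s)) = R.m y := rfl
      rw [this] at h1
      have h2 : 0 ≤ R.m y * (Real.exp 6 ^ 2 * y^2 * (R.D k ^ 3 * R.D l ^ 3)) := by positivity
      linarith
    · rw [zero_add]
      by_cases hk : k + e ∈ R.W
      · by_cases hl : l + e ∈ R.W
        · exact R.cross e he u hodd hfar hbd y hy hyD k l hk hl (not_le.mp h)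
        · have : (fun s => Real.exp (y * R.F s) * (u k s * u l s)) = fun s => 0 * 0 := by
            funext s; rw [hzero l hl]; ring
          rw [this, ex_mul_left, zero_mul]; positivity
      · have : (fun s => Real.exp (y * R.F s) * (u k s * u l s)) = fun s => 0 * 0 := by
            funext s; rw [hzero k hk]; ring
        rw [this, ex_mul_left, zero_mul]; positivity
  refine (Finset.sum_le_sum fun k _ => Finset.sum_le_sum fun l _ => hb k l).trans ?_
  simp only [← Finset.mul_sum, Finset.sum_add_distrib]
  refine mul_le_mul_of_nonneg_left ?_ hm
  refine add_le_add ?_ (le_of_eq ?_)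
  · have c : ∀ k, ∑ l ∈ R.W, (if |k - l| ≤ 2 then (1:ℝ) else 0) ≤ 5 := by
      intro k
      rw [← Finset.sum_filter, Finset.sum_const, nsmul_eq_mul, mul_one]
      have : (R.W.filter fun l => |k - l| ≤ 2) ⊆ Finset.Icc (k-2) (k+2) := by
        intro l hl
        rw [Finset.mem_filter, abs_le] at hl
        rw [Finset.mem_Icc]; omega
      have h2 := Finset.card_le_card this
      rw [Int.card_Icc] at h2
      have h3 : (R.W.filter fun l => |k - l| ≤ 2).card ≤ 5 := by omega
      exact_mod_cast h3
    have s1 : ∑ k ∈ R.W, ∑ l ∈ R.W, (if |k - l| ≤ 2 then (R.D k ^ 4 + R.D l ^ 4)/2 else 0) =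
        ∑ k ∈ R.W, ∑ l ∈ R.W, (if |k - l| ≤ 2 then (1:ℝ) else 0) * (R.D k ^ 4 /2)
        + ∑ k ∈ R.W, ∑ l ∈ R.W, (if |k - l| ≤ 2 then (1:ℝ) else 0) * (R.D l ^ 4 /2) := by
      rw [← Finset.sum_add_distrib]
      refine Finset.sum_congr rfl fun k _ => ?_
      rw [← Finset.sum_add_distrib]
      refine Finset.sum_congr rfl fun l _ => ?_
      split_ifs <;> ring
    have s2 : ∑ k ∈ R.W, ∑ l ∈ R.W, (if |k - l| ≤ 2 then (1:ℝ) else 0) * (R.D l ^ 4 /2)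
        = ∑ k ∈ R.W, ∑ l ∈ R.W, (if |k - l| ≤ 2 then (1:ℝ) else 0) * (R.D k ^ 4 /2) := by
      rw [Finset.sum_comm]
      refine Finset.sum_congr rfl fun k _ => Finset.sum_congr rfl fun l _ => ?_
      rw [abs_sub_comm]
    have s3 : ∑ k ∈ R.W, ∑ l ∈ R.W, (if |k - l| ≤ 2 then (1:ℝ) else 0) * (R.D k ^ 4 /2) ≤ ∑ k ∈ R.W, 5 * (R.D k ^ 4 /2) := by
      refine Finset.sum_le_sum fun k _ => ?_
      rw [← Finset.sum_mul]
      exact mul_le_mul_of_nonneg_right (c k) (by have := hD k; positivity)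
    rw [s1, s2]
    have s4 : ∑ k ∈ R.W, 5 * (R.D k ^ 4 /2) = 5/2 * ∑ k ∈ R.W, R.D k ^ 4 := by
      rw [Finset.mul_sum]; refine Finset.sum_congr rfl fun k _ => ?_; ring
    linarith
  · rw [pow_two (∑ k ∈ R.W, R.D k ^ 3), Finset.sum_mul]

end RW


namespace RW
variable {S : Type} (R : RW S)

lemma shift_le (f : ℤ → ℝ) (h0 : ∀ i, 0 ≤ f i) (h1 : ∀ i, i ∉ R.W → f i = 0) (e : ℤ) :
    ∑ k ∈ R.W, f (k+e) ≤ ∑ k ∈ R.W, f k := by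
  have h2 : ∑ k ∈ R.W, f (k+e) = ∑ j ∈ R.W.map (addRightEmbedding e), f j := by
    rw [Finset.sum_map]; rfl
  rw [h2, ← Finset.sum_filter_add_sum_filter_not _ (fun j => j ∈ R.W)]
  have h3 : ∑ j ∈ (R.W.map (addRightEmbedding e)).filter (fun j => ¬ j ∈ R.W), f j = 0 :=
    Finset.sum_eq_zero fun j hj => h1 j (Finset.mem_filter.1 hj).2
  rw [h3, add_zero]
  exact Finset.sum_le_sum_of_subset_of_nonneg (fun j hj => (Finset.mem_filter.1 hj).2) (fun i _ _ => h0 i)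

lemma sumD2 : ∑ k ∈ R.W, R.D k ^ 2 ≤ 16 * ∑ k ∈ R.W, R.b k ^ 2 := by
  have h : ∀ k, R.D k ^ 2 ≤ 4 * (R.b (k+(-2)) ^ 2 + R.b (k+(-1)) ^ 2 + R.b (k+0) ^ 2 + R.b (k+1) ^ 2) := by
    intro k
    unfold D
    rw [← sq_abs (R.b (k+(-2))), ← sq_abs (R.b (k+(-1))), ← sq_abs (R.b (k+0)), ← sq_abs (R.b (k+1)),
      ← sub_eq_add_neg, ← sub_eq_add_neg, add_zero]
    generalize |R.b (k-2)| = a; generalize |R.b (k-1)| = b; generalize |R.b (k)| = c; generalize |R.b (k+1)| = d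
    nlinarith [sq_nonneg (a-b), sq_nonneg (a-c), sq_nonneg (a-d), sq_nonneg (b-c), sq_nonneg (b-d), sq_nonneg (c-d)]
  have hs := fun e => R.shift_le (fun i => R.b i ^ 2) (fun i => sq_nonneg _) (fun i hi => by simp [R.hb1 i hi]) e
  refine (Finset.sum_le_sum fun k _ => h k).trans ?_
  rw [← Finset.mul_sum, Finset.sum_add_distrib, Finset.sum_add_distrib, Finset.sum_add_distrib]
  have := hs (-2); have := hs (-1); have := hs 0; have := hs 1
  linarith

lemma sumD4 : ∑ k ∈ R.W, R.D k ^ 4 ≤ 256 * ∑ k ∈ R.W, R.b k ^ 4 := by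
  have h : ∀ k, R.D k ^ 4 ≤ 64 * (R.b (k+(-2)) ^ 4 + R.b (k+(-1)) ^ 4 + R.b (k+0) ^ 4 + R.b (k+1) ^ 4) := by
    intro k
    unfold D
    have ev : ∀ t : ℝ, t^4 = |t|^4 := fun t => by rw [← abs_pow, abs_of_nonneg (by positivity)]
    rw [ev (R.b (k+(-2))), ev (R.b (k+(-1))), ev (R.b (k+0)), ev (R.b (k+1)),
      ← sub_eq_add_neg, ← sub_eq_add_neg, add_zero]
    generalize |R.b (k-2)| = a; generalize |R.b (k-1)| = b; generalize |R.b (k)| = c; generalize |R.b (k+1)| = d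
    have g : ∀ a b c d : ℝ, (a+b+c+d)^2 ≤ 4 * (a^2+b^2+c^2+d^2) := by
      intro a b c d
      nlinarith [sq_nonneg (a-b), sq_nonneg (a-c), sq_nonneg (a-d), sq_nonneg (b-c), sq_nonneg (b-d), sq_nonneg (c-d)]
    have g1 := g a b c d
    have g2 := g (a^2) (b^2) (c^2) (d^2)
    have g3 : ((a+b+c+d)^2)^2 ≤ (4 * (a^2+b^2+c^2+d^2))^2 := pow_le_pow_left₀ (sq_nonneg _) g1 2
    nlinarith
  have hs := fun e => R.shift_le (fun i => R.b i ^ 4) (fun i => by positivity) (fun i hi => by simp [R.hb1 i hi]) e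
  refine (Finset.sum_le_sum fun k _ => h k).trans ?_
  rw [← Finset.mul_sum, Finset.sum_add_distrib, Finset.sum_add_distrib, Finset.sum_add_distrib]
  have := hs (-2); have := hs (-1); have := hs 0; have := hs 1
  linarith

lemma sumD3 (L : ℝ) (hL : 0 ≤ L) (h4 : ∑ k ∈ R.W, R.b k ^ 4 = L^2) (h2 : ∑ k ∈ R.W, R.b k ^ 2 ≤ 16) :
    ∑ k ∈ R.W, R.D k ^ 3 ≤ 256 * L := by
  have h := Finset.sum_mul_sq_le_sq_mul_sq R.W (fun k => R.D k) (fun k => R.D k ^ 2)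
  have e1 : ∀ k, R.D k * R.D k ^ 2 = R.D k ^ 3 := fun k => by ring
  have e2 : ∀ k, (R.D k ^ 2) ^ 2 = R.D k ^ 4 := fun k => by ring
  simp only [e1, e2] at h
  have a2 := R.sumD2
  have a4 := R.sumD4
  rw [h4] at a4
  have : (∑ k ∈ R.W, R.D k ^ 3)^2 ≤ (256 * L)^2 := by
    refine h.trans ?_
    calc _ ≤ (256:ℝ) * (256 * L^2) := mul_le_mul (by linarith) a4 (Finset.sum_nonneg fun k _ => by positivity) (by norm_num)
      _ = _ := by ring
  exact (le_abs_self _).trans (abs_le_of_sq_le_sq this (by positivity))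

lemma yD (L : ℝ) (h4 : ∑ k ∈ R.W, R.b k ^ 4 = L^2) (hL : 0 ≤ L) (y : ℝ) (hy : 0 ≤ y) (hyL : y^2 * L ≤ 2) (k : ℤ) :
    y * R.D k ≤ 6 := by
  have h : ∀ i, y * |R.b i| ≤ 3/2 := by
    intro i
    have h1 : R.b i ^ 4 ≤ L^2 := by
      by_cases hi : i ∈ R.W
      · rw [← h4]
        exact Finset.single_le_sum (f := fun i => R.b i ^ 4) (fun i _ => by positivity) hi
      · rw [R.hb1 i hi]; simpa using sq_nonneg L
    have h2 : (R.b i ^ 2)^2 ≤ L^2 := by rw [← pow_mul]; exact h1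
    have h3 : R.b i ^ 2 ≤ L := (le_abs_self _).trans (abs_le_of_sq_le_sq h2 hL)
    have h5 : (y * |R.b i|)^2 ≤ (3/2)^2 := by
      rw [mul_pow, sq_abs]
      nlinarith [mul_le_mul_of_nonneg_left h3 (sq_nonneg y)]
    exact (le_abs_self _).trans (abs_le_of_sq_le_sq h5 (by norm_num))
  unfold D
  have := h (k-2); have := h (k-1); have := h k; have := h (k+1)
  nlinarith

noncomputable def u1 (k : ℤ) (s : S) : ℝ := 3/32 * ((R.b (k-1) + R.b k) * R.b (k-1) * R.x (k-1) s)
noncomputable def u2 (k : ℤ) (s : S) : ℝ := 3/32 * ((R.b (k-1) + R.b k) * R.b k * R.x (k+1) s)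
noncomputable def u3 (k : ℤ) (s : S) : ℝ := 1/16 * (R.b (k-1) * R.b k * (R.x (k-1) s * R.x (k+1) s))
noncomputable def u4 (k : ℤ) (s : S) : ℝ := 1/4 * (|R.P k s| * (R.x k s * R.Q k s))
noncomputable def T0 : ℝ := ∑ k ∈ R.W, 1/16 * ((R.b (k-1) + R.b k)^2 + (R.b (k-1)^2 + R.b k^2)/2)

lemma T_eq (s : S) : R.T s = R.T0 + (∑ k ∈ R.W, R.u1 k s + ∑ k ∈ R.W, R.u2 k s + ∑ k ∈ R.W, R.u3 k s) := by
  unfold T T0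
  simp only [← Finset.sum_add_distrib]
  refine Finset.sum_congr rfl fun k _ => ?_
  unfold P Q u1 u2 u3
  have h1 := R.x_sq (k-1) s
  have h2 := R.x_sq (k+1) s
  linear_combination (1/32 * R.b (k-1)^2) * h1 + (1/32 * R.b k ^2) * h2

variable [Fintype S]

/-- tilted bound for a local odd family -/
lemma tilt (e : ℤ) (he : e = 0 ∨ e = 1 ∨ e = -1) (u : ℤ → S → ℝ)
    (hodd : ∀ k, k + e ∈ R.W → ∀ s, u k (R.φ (k+e) s) = - u k s)
    (hzero : ∀ k, k + e ∉ R.W → ∀ s, u k s = 0)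
    (hfar : ∀ k l s, 2 < |k - l| → u l (R.φ (k+e) s) = u l s)
    (hbd : ∀ k s, |u k s| ≤ R.D k ^ 2) (L : ℝ) (hL : 0 ≤ L) (h4 : ∑ k ∈ R.W, R.b k ^ 4 = L^2)
    (h2 : ∑ k ∈ R.W, R.b k ^ 2 ≤ 16) (y : ℝ) (hy : 0 ≤ y) (hyL : y^2 * L ≤ 2) :
    ex (fun s => Real.exp (y * R.F s) * |∑ k ∈ R.W, u k s|) ≤ 256 * Real.exp 6 * (1+y) * L * R.m y := by
  have h := R.keyLemma e he u hodd hzero hfar hbd y hy (R.yD L h4 hL y hy hyL)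
  refine ex_cs (fun s => Real.exp (y * R.F s)) (fun s => ∑ k ∈ R.W, u k s) (fun s => (Real.exp_pos _).le) _ (by positivity) ?_
  refine h.trans ?_
  change _ ≤ _ * R.m y
  rw [mul_comm]
  refine mul_le_mul_of_nonneg_right ?_ (R.m_nonneg y)
  have a4 := R.sumD4
  rw [h4] at a4
  have a3 := R.sumD3 L hL h4 h2
  have a30 : 0 ≤ ∑ k ∈ R.W, R.D k ^ 3 := Finset.sum_nonneg fun k _ => pow_nonneg (R.D_nonneg k) 3
  have a33 : (∑ k ∈ R.W, R.D k ^ 3)^2 ≤ (256 * L)^2 := pow_le_pow_left₀ a30 a3 2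
  have e1 : 1 ≤ Real.exp 6 := Real.one_le_exp (by norm_num)
  set M := Real.exp 6
  have e2 : 1 ≤ M^2 := by nlinarith
  have b1 : M^2 * y^2 * (∑ k ∈ R.W, R.D k ^ 3)^2 ≤ M^2 * y^2 * (256 * L)^2 := by gcongr
  have b2 : 5 * (256 * L^2) ≤ M^2 * 65536 * L^2 := by nlinarith [sq_nonneg L]
  have b3 : 0 ≤ M^2 * 65536 * L^2 * y := by positivity
  nlinarith

lemma ex_u (e : ℤ) (u : ℤ → S → ℝ)
    (hodd : ∀ k, k + e ∈ R.W → ∀ s, u k (R.φ (k+e) s) = - u k s)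
    (hzero : ∀ k, k + e ∉ R.W → ∀ s, u k s = 0) : ex (fun s => ∑ k ∈ R.W, u k s) = 0 := by
  rw [ex_sum]
  refine Finset.sum_eq_zero fun k _ => ?_
  by_cases hk : k + e ∈ R.W
  · have := ex_odd (R.hinv (k+e)) (fun _ => 1) (u k) (hodd k hk)
    simp only [one_mul, sub_self, zero_mul] at this
    rw [this]; simp [ex]
  · have : u k = fun _ => 0 := funext fun s => hzero k hk s
    rw [this]; simp [ex]

section fam
lemma u1_odd : ∀ k, k + (-1) ∈ R.W → ∀ s, R.u1 k (R.φ (k+(-1)) s) = - R.u1 k s := by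
  intro k hk s
  rw [← sub_eq_add_neg] at *
  unfold u1; rw [R.hflip _ hk]; ring
lemma u1_zero : ∀ k, k + (-1) ∉ R.W → ∀ s, R.u1 k s = 0 := by
  intro k hk s
  rw [← sub_eq_add_neg] at *
  unfold u1; rw [R.hb1 _ hk]; ring
lemma u1_far : ∀ k l s, 2 < |k - l| → R.u1 l (R.φ (k+(-1)) s) = R.u1 l s := by
  intro k l s h
  unfold u1; rw [R.hoth]
  rcases lt_abs.1 h with h | h <;> omega
lemma u2_odd : ∀ k, k + 1 ∈ R.W → ∀ s, R.u2 k (R.φ (k+1) s) = - R.u2 k s := by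
  intro k hk s
  unfold u2; rw [R.hflip _ hk]; ring
lemma u2_zero : ∀ k, k + 1 ∉ R.W → ∀ s, R.u2 k s = 0 := by
  intro k hk s
  unfold u2; rw [R.hb2 _ hk]; ring
lemma u2_far : ∀ k l s, 2 < |k - l| → R.u2 l (R.φ (k+1) s) = R.u2 l s := by
  intro k l s h
  unfold u2; rw [R.hoth]
  rcases lt_abs.1 h with h | h <;> omega
lemma u3_odd : ∀ k, k + (-1) ∈ R.W → ∀ s, R.u3 k (R.φ (k+(-1)) s) = - R.u3 k s := by
  intro k hk s
  rw [← sub_eq_add_neg] at *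
  unfold u3; rw [R.hflip _ hk, R.hoth (k+1) (k-1) s (by omega)]; ring
lemma u3_zero : ∀ k, k + (-1) ∉ R.W → ∀ s, R.u3 k s = 0 := by
  intro k hk s
  rw [← sub_eq_add_neg] at *
  unfold u3; rw [R.hb1 _ hk]; ring
lemma u3_far : ∀ k l s, 2 < |k - l| → R.u3 l (R.φ (k+(-1)) s) = R.u3 l s := by
  intro k l s h
  unfold u3
  rcases lt_abs.1 h with h | h <;> rw [R.hoth _ _ _ (by omega), R.hoth _ _ _ (by omega)]
lemma u4_odd : ∀ k, k + 0 ∈ R.W → ∀ s, R.u4 k (R.φ (k+0) s) = - R.u4 k s := by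
  intro k hk s
  rw [add_zero] at *
  unfold u4; rw [R.hflip _ hk, R.P_inv k k s (by omega) (by omega), R.Q_inv k k s (by omega) (by omega)]; ring
lemma u4_zero' : ∀ k, k + 0 ∉ R.W → ∀ s, R.u4 k s = 0 := by
  intro k hk s
  rw [add_zero] at hk
  have h1 : R.b (k-1) = 0 := R.hb2 _ (by rwa [sub_add_cancel])
  unfold u4 Q; rw [R.hb1 _ hk, h1]; ring
lemma u4_far : ∀ k l s, 2 < |k - l| → R.u4 l (R.φ (k+0) s) = R.u4 l s := by
  intro k l s h
  rw [add_zero]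
  unfold u4
  rcases lt_abs.1 h with h | h <;>
  rw [R.hoth l k s (by omega), R.P_inv k l s (by omega) (by omega), R.Q_inv k l s (by omega) (by omega)]

lemma u1_bd : ∀ k s, |R.u1 k s| ≤ R.D k ^ 2 := by
  intro k s
  unfold u1 D
  rw [abs_mul, abs_mul, abs_mul, R.x_abs]
  have h := abs_add_le (R.b (k-1)) (R.b k)
  have p1 := abs_nonneg (R.b (k-1)); have p2 := abs_nonneg (R.b k)
  have p3 := abs_nonneg (R.b (k-2)); have p4 := abs_nonneg (R.b (k+1))
  have h2 := mul_le_mul_of_nonneg_right h p1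
  rw [abs_of_pos (by norm_num : (0:ℝ) < 3/32)]
  nlinarith [mul_nonneg p1 p2, mul_nonneg p1 p3, mul_nonneg p1 p4, mul_nonneg p2 p3, mul_nonneg p2 p4, mul_nonneg p3 p4]
lemma u2_bd : ∀ k s, |R.u2 k s| ≤ R.D k ^ 2 := by
  intro k s
  unfold u2 D
  rw [abs_mul, abs_mul, abs_mul, R.x_abs]
  have h := abs_add_le (R.b (k-1)) (R.b k)
  have p1 := abs_nonneg (R.b (k-1)); have p2 := abs_nonneg (R.b k)
  have p3 := abs_nonneg (R.b (k-2)); have p4 := abs_nonneg (R.b (k+1))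
  have h2 := mul_le_mul_of_nonneg_right h p2
  rw [abs_of_pos (by norm_num : (0:ℝ) < 3/32)]
  nlinarith [mul_nonneg p1 p2, mul_nonneg p1 p3, mul_nonneg p1 p4, mul_nonneg p2 p3, mul_nonneg p2 p4, mul_nonneg p3 p4]
lemma u3_bd : ∀ k s, |R.u3 k s| ≤ R.D k ^ 2 := by
  intro k s
  unfold u3 D
  rw [abs_mul, abs_mul, abs_mul, abs_mul, R.x_abs, R.x_abs]
  have p1 := abs_nonneg (R.b (k-1)); have p2 := abs_nonneg (R.b k)
  have p3 := abs_nonneg (R.b (k-2)); have p4 := abs_nonneg (R.b (k+1))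
  rw [abs_of_pos (by norm_num : (0:ℝ) < 1/16)]
  nlinarith [mul_nonneg p1 p2, mul_nonneg p1 p3, mul_nonneg p1 p4, mul_nonneg p2 p3, mul_nonneg p2 p4, mul_nonneg p3 p4]
lemma u4_bd : ∀ k s, |R.u4 k s| ≤ R.D k ^ 2 := by
  intro k s
  unfold u4
  rw [abs_mul, abs_mul, abs_mul, R.x_abs, abs_abs]
  have h1 := R.P_le_D k s
  have h2 := R.Q_le_D k 0 (Or.inl rfl) s
  rw [add_zero] at h2
  have h3 := mul_le_mul h1 h2 (abs_nonneg _) (R.D_nonneg k)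
  rw [abs_of_pos (by norm_num : (0:ℝ) < 1/4)]
  nlinarith [sq_nonneg (R.D k)]
end fam

lemma ex_T : ex R.T = ex (fun s => R.F s * R.F s) := by
  rw [R.stein R.F]
  unfold T
  rw [ex_sum]
  refine Finset.sum_congr rfl fun k hk => ?_
  rw [ex_mul_left]
  congr 2
  funext s
  rw [R.F_flip k hk]
  linear_combination (- R.P k s * R.Q k s) * R.x_sq k s

variable [Nonempty S]

lemma T0_eq (hv : ex (fun s => R.F s * R.F s) = 1) : R.T0 = 1 := by
  rw [← hv, ← ex_T]
  have : R.T = fun s => R.T0 + (∑ k ∈ R.W, R.u1 k s + ∑ k ∈ R.W, R.u2 k s + ∑ k ∈ R.W, R.u3 k s) := funext R.T_eq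
  rw [this, ex_add, ex_add, ex_add, ex_const, R.ex_u (-1) R.u1 R.u1_odd R.u1_zero, R.ex_u 1 R.u2 R.u2_odd R.u2_zero,
    R.ex_u (-1) R.u3 R.u3_odd R.u3_zero]
  ring

lemma sumb2 (hv : ex (fun s => R.F s * R.F s) = 1) : ∑ k ∈ R.W, R.b k ^ 2 ≤ 16 := by
  have h := R.T0_eq hv
  have hs := R.shift_sum (fun i => R.b i ^ 2) (fun i hi => by simp [R.hb1 i hi]) (fun i hi => by simp [R.hb2 i hi])
  unfold T0 at h
  have h2 : ∑ k ∈ R.W, (1/32 * R.b (k-1)^2 + 1/32 * R.b k ^2) ≤ 1 := by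
    rw [← h]
    refine Finset.sum_le_sum fun k _ => ?_
    nlinarith [sq_nonneg (R.b (k-1) + R.b k)]
  rw [Finset.sum_add_distrib, ← Finset.mul_sum, ← Finset.mul_sum, hs] at h2
  linarith

lemma tilt_T (hv : ex (fun s => R.F s * R.F s) = 1) (L : ℝ) (hL : 0 ≤ L) (h4 : ∑ k ∈ R.W, R.b k ^ 4 = L^2)
    (y : ℝ) (hy : 0 ≤ y) (hyL : y^2 * L ≤ 2) :
    ex (fun s => Real.exp (y * R.F s) * |R.T s - 1|) ≤ 3 * (256 * Real.exp 6 * (1+y) * L * R.m y) := by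
  have h2 := R.sumb2 hv
  have a1 := R.tilt (-1) (by simp) R.u1 R.u1_odd R.u1_zero R.u1_far R.u1_bd L hL h4 h2 y hy hyL
  have a2 := R.tilt 1 (by simp) R.u2 R.u2_odd R.u2_zero R.u2_far R.u2_bd L hL h4 h2 y hy hyL
  have a3 := R.tilt (-1) (by simp) R.u3 R.u3_odd R.u3_zero R.u3_far R.u3_bd L hL h4 h2 y hy hyL
  have : ex (fun s => Real.exp (y * R.F s) * |R.T s - 1|) ≤ ex (fun s => Real.exp (y * R.F s) * |∑ k ∈ R.W, R.u1 k s|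
    + Real.exp (y * R.F s) * |∑ k ∈ R.W, R.u2 k s| + Real.exp (y * R.F s) * |∑ k ∈ R.W, R.u3 k s|) := by
    refine ex_mono fun s => ?_
    rw [← mul_add, ← mul_add]
    refine mul_le_mul_of_nonneg_left ?_ (Real.exp_pos _).le
    rw [R.T_eq, R.T0_eq hv, add_sub_cancel_left]
    exact abs_add_three _ _ _
  rw [ex_add, ex_add] at this
  linarith

lemma tilt_u4 (hv : ex (fun s => R.F s * R.F s) = 1) (L : ℝ) (hL : 0 ≤ L) (h4 : ∑ k ∈ R.W, R.b k ^ 4 = L^2)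
    (y : ℝ) (hy : 0 ≤ y) (hyL : y^2 * L ≤ 2) :
    ex (fun s => Real.exp (y * R.F s) * |∑ k ∈ R.W, R.u4 k s|) ≤ 256 * Real.exp 6 * (1+y) * L * R.m y :=
  R.tilt 0 (by simp) R.u4 R.u4_odd R.u4_zero' R.u4_far R.u4_bd L hL h4 (R.sumb2 hv) y hy hyL

/-- derivative of the mgf -/
lemma m_deriv (y : ℝ) : HasDerivAt R.m (ex (fun s => R.F s * Real.exp (y * R.F s))) y := by
  unfold m ex
  refine HasDerivAt.div_const ?_ _
  refine HasDerivAt.fun_sum fun s _ => ?_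
  have h : HasDerivAt (fun y => y * R.F s) (R.F s) y := by simpa using (hasDerivAt_id y).mul_const (R.F s)
  exact h.exp.congr_deriv (by ring)

lemma m_deriv_le (hv : ex (fun s => R.F s * R.F s) = 1) (L : ℝ) (hL : 0 ≤ L) (h4 : ∑ k ∈ R.W, R.b k ^ 4 = L^2)
    (y : ℝ) (hy : 0 ≤ y) (hyL : y^2 * L ≤ 2) :
    ex (fun s => R.F s * Real.exp (y * R.F s)) ≤ (y + 1024 * Real.exp 6 * L * (y + y^2)) * R.m y := by
  have hD := R.yD L h4 hL y hy hyL
  rw [R.stein]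
  have hk : ∀ k ∈ R.W, 1/4 * ex (fun s => (Real.exp (y * R.F s) - Real.exp (y * R.F (R.φ k s))) * (R.x k s * R.P k s)) ≤
      ex (fun s => y * (Real.exp (y * R.F s) * (1/4 * (R.P k s * R.Q k s))) + Real.exp 6 * y^2 * R.D k ^ 3 * Real.exp (y * R.F s)) := by
    intro k hk
    rw [← ex_mul_left]
    refine ex_mono fun s => ?_
    rw [R.exp_flip y k hk]
    set E := Real.exp (y * R.F s)
    have hE : 0 < E := Real.exp_pos _
    have hQ := R.Q_le_D k 0 (Or.inl rfl) s
    rw [add_zero] at hQ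
    have hP := R.P_le_D k s
    have hD0 := R.D_nonneg k
    set t := -(y * (R.x k s * R.Q k s)) with ht
    have h1 : |t| ≤ y * R.D k := by
      rw [ht, abs_neg, abs_mul, abs_mul, R.x_abs, abs_of_nonneg hy, one_mul]
      exact mul_le_mul_of_nonneg_left hQ hy
    have h2 := abs_exp_sub_two t
    have h3 : t^2 * Real.exp |t| ≤ (y * R.D k)^2 * Real.exp 6 := by
      rw [← sq_abs]
      have := Real.exp_le_exp.2 (h1.trans (hD k))
      gcongr
    have h5 : 1/4 * ((E - E * Real.exp t) * (R.x k s * R.P k s)) = E * (y * (1/4 * (R.P k s * R.Q k s)) +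
        1/4 * (-(Real.exp t - 1 - t) * (R.x k s * R.P k s))) := by
      have : t * R.x k s = - y * R.Q k s := by rw [ht]; linear_combination (-y * R.Q k s) * R.x_sq k s
      linear_combination (-1/4 * E * R.P k s) * this
    rw [h5]
    have h6 : 1/4 * (-(Real.exp t - 1 - t) * (R.x k s * R.P k s)) ≤ Real.exp 6 * y^2 * R.D k ^ 3 := by
      have h7 : -(Real.exp t - 1 - t) * (R.x k s * R.P k s) ≤ ((y * R.D k)^2 * Real.exp 6) * R.D k := by
        refine (le_abs_self _).trans ?_
        rw [abs_mul, abs_neg, abs_mul, R.x_abs, one_mul]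
        exact mul_le_mul (h2.trans h3) hP (abs_nonneg _) (by positivity)
      have h8 : 0 ≤ Real.exp 6 * y^2 * R.D k ^ 3 := by positivity
      nlinarith
    nlinarith [mul_le_mul_of_nonneg_left h6 hE.le]
  refine (Finset.sum_le_sum hk).trans ?_
  rw [← ex_sum]
  have e1 : (fun s => ∑ k ∈ R.W, (y * (Real.exp (y * R.F s) * (1/4 * (R.P k s * R.Q k s))) + Real.exp 6 * y^2 * R.D k ^ 3 * Real.exp (y * R.F s)))
     = fun s => y * (Real.exp (y * R.F s) * R.T s) + (Real.exp 6 * y^2 * ∑ k ∈ R.W, R.D k ^ 3) * Real.exp (y * R.F s) := by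
    funext s
    rw [Finset.sum_add_distrib]
    unfold T
    rw [Finset.mul_sum, Finset.mul_sum, Finset.mul_sum, Finset.sum_mul]
  rw [e1, ex_add, ex_mul_left, ex_mul_left]
  have a1 : ex (fun s => Real.exp (y * R.F s) * R.T s) ≤ R.m y + 3 * (256 * Real.exp 6 * (1+y) * L * R.m y) := by
    refine le_trans ?_ (add_le_add_right (R.tilt_T hv L hL h4 y hy hyL) _)
    unfold m
    rw [← ex_add]
    refine ex_mono fun s => ?_
    nlinarith [mul_le_mul_of_nonneg_left (le_abs_self (R.T s - 1)) (Real.exp_pos (y * R.F s)).le]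
  have a3 := R.sumD3 L hL h4 (R.sumb2 hv)
  have hm := R.m_nonneg y
  have : ex (fun s => Real.exp (y * R.F s)) = R.m y := rfl
  rw [this]
  have b1 : Real.exp 6 * y^2 * ∑ k ∈ R.W, R.D k ^ 3 ≤ Real.exp 6 * y^2 * (256 * L) := by gcongr
  have b2 := mul_le_mul_of_nonneg_right b1 hm
  have b3 := mul_le_mul_of_nonneg_left a1 hy
  have b4 : y * (R.m y + 3 * (256 * Real.exp 6 * (1 + y) * L * R.m y)) + Real.exp 6 * y^2 * (256 * L) * R.m y =
    (y + 1024 * Real.exp 6 * L * (y + y^2)) * R.m y - 256 * Real.exp 6 * L * y * R.m y := by ring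
  have b5 : 0 ≤ 256 * Real.exp 6 * L * y * R.m y := by positivity
  linarith

lemma m_le (hv : ex (fun s => R.F s * R.F s) = 1) (L : ℝ) (hL : 0 ≤ L) (h4 : ∑ k ∈ R.W, R.b k ^ 4 = L^2)
    (z : ℝ) (hz : 0 ≤ z) (hzL : z^2 * L ≤ 2) (hzL3 : z^3 * L ≤ 2) :
    R.m z ≤ Real.exp (4096 * Real.exp 6) * Real.exp (z^2/2) := by
  set c := 1024 * Real.exp 6 * L with hc
  let g : ℝ → ℝ := fun y => R.m y * Real.exp (-(y^2/2 + c * (y^2/2 + y^3/3)))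
  have hd : ∀ y, HasDerivAt g (ex (fun s => R.F s * Real.exp (y * R.F s)) * Real.exp (-(y^2/2 + c * (y^2/2 + y^3/3)))
      + R.m y * (Real.exp (-(y^2/2 + c * (y^2/2 + y^3/3))) * (-(y + c * (y + y^2))))) y := by
    intro y
    refine (R.m_deriv y).mul (HasDerivAt.exp ?_)
    have q2 : HasDerivAt (fun y : ℝ => y^2/2) y y := ((hasDerivAt_pow 2 y).div_const 2).congr_deriv (by norm_num)
    have q3 : HasDerivAt (fun y : ℝ => y^3/3) (y^2) y := ((hasDerivAt_pow 3 y).div_const 3).congr_deriv (by norm_num)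
    exact (q2.fun_add ((q2.fun_add q3).const_mul c)).fun_neg
  have hanti : AntitoneOn g (Set.Icc 0 z) := by
    refine antitoneOn_of_deriv_nonpos (convex_Icc 0 z) (fun y _ => (hd y).continuousAt.continuousWithinAt)
      (fun y _ => (hd y).differentiableAt.differentiableWithinAt) ?_
    intro y hy
    rw [interior_Icc] at hy
    rw [(hd y).deriv]
    have hyL : y^2 * L ≤ 2 := by
      refine le_trans (mul_le_mul_of_nonneg_right ?_ hL) hzL
      exact pow_le_pow_left₀ hy.1.le hy.2.le 2
    have := R.m_deriv_le hv L hL h4 y hy.1.le hyL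
    have hE := Real.exp_pos (-(y^2/2 + c * (y^2/2 + y^3/3)))
    nlinarith [mul_le_mul_of_nonneg_right this hE.le]
  have h := hanti (Set.left_mem_Icc.2 hz) (Set.right_mem_Icc.2 hz) hz
  have h0 : g 0 = 1 := by
    simp only [g, m]; simp [ex_const]
  rw [h0] at h
  have h1 : R.m z ≤ Real.exp (z^2/2 + c * (z^2/2 + z^3/3)) := by
    have h2 : g z = R.m z / Real.exp (z^2/2 + c * (z^2/2 + z^3/3)) := by
      simp only [g]; rw [Real.exp_neg]; rfl
    rw [h2, div_le_one (Real.exp_pos _)] at h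
    exact h
  refine h1.trans ?_
  rw [← Real.exp_add]
  apply Real.exp_le_exp.2
  have : c * (z^2/2 + z^3/3) = 1024 * Real.exp 6 * (z^2 * L/2 + z^3 * L/3) := by rw [hc]; ring
  rw [this]
  have hE := Real.exp_pos 6
  have : 1024 * Real.exp 6 * (z^2 * L/2 + z^3 * L/3) ≤ 1024 * Real.exp 6 * 4 := by
    apply mul_le_mul_of_nonneg_left _ (by positivity); linarith
  linarith

end RW


namespace RW
variable {S : Type} (R : RW S) [Fintype S] [Nonempty S]

lemma stein_dev (z : ℝ) (hz : 0 ≤ z) : |ex (fun s => hJ z (R.F s)) - gQ z| ≤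
    ex (fun s => |R.T s - 1| * fM z (R.F s)) + 2 * ex (fun s => |∑ k ∈ R.W, R.u4 k s| * fM z (R.F s)) := by
  have h1 : ex (fun s => hJ z (R.F s)) - gQ z = ex (fun s => R.F s * fS z (R.F s)) - ex (fun s => fD z (R.F s)) := by
    rw [← ex_sub]
    have : (fun s => R.F s * fS z (R.F s) - fD z (R.F s)) = fun s => hJ z (R.F s) - gQ z := by
      funext s; unfold fD; ring
    rw [this, ex_sub, ex_const]
  have h2 : ex (fun s => R.F s * fS z (R.F s)) = ex (fun s => R.T s * fD z (R.F s)) +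
      ∑ k ∈ R.W, ex (fun s => 1/4 * ((fS z (R.F s) - fS z (R.F (R.φ k s)) - (R.x k s * R.Q k s) * fD z (R.F s)) * (R.x k s * R.P k s))) := by
    rw [R.stein (fun s => fS z (R.F s))]
    have e : (fun s => R.T s * fD z (R.F s)) = fun s => ∑ k ∈ R.W, 1/4 * (R.P k s * R.Q k s) * fD z (R.F s) := by
      funext s; unfold T; rw [Finset.sum_mul]
    rw [e, ex_sum, ← Finset.sum_add_distrib]
    refine Finset.sum_congr rfl fun k _ => ?_
    rw [← ex_add, ← ex_mul_left]
    congr 1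
    funext s
    linear_combination (1/4 * R.P k s * R.Q k s * fD z (R.F s)) * R.x_sq k s
  have h3 : ∀ k ∈ R.W, |ex (fun s => 1/4 * ((fS z (R.F s) - fS z (R.F (R.φ k s)) - (R.x k s * R.Q k s) * fD z (R.F s)) * (R.x k s * R.P k s)))|
      ≤ 2 * ex (fun s => fH z (R.F s) * R.u4 k s) := by
    intro k hk
    have ho : ∀ s, R.u4 k (R.φ k s) = - R.u4 k s := by
      intro s
      have := R.u4_odd k (by rwa [add_zero]) s
      rwa [add_zero] at this
    rw [ex_odd (R.hinv k) (fun s => fH z (R.F s)) (R.u4 k) ho, ← mul_assoc]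
    norm_num only [one_mul]
    refine (ex_abs_le _).trans (ex_mono fun s => ?_)
    have hi := fS_incr z (R.F s) (R.F (R.φ k s))
    have hd : R.F s - R.F (R.φ k s) = R.x k s * R.Q k s := by rw [R.F_flip k hk]; ring
    rw [hd] at hi
    rw [abs_mul, abs_mul, abs_mul, R.x_abs, one_mul, abs_of_pos (by norm_num : (0:ℝ) < 1/4)]
    unfold u4
    have := mul_le_mul_of_nonneg_right hi (abs_nonneg (R.P k s))
    nlinarith
  have h4 : |∑ k ∈ R.W, ex (fun s => 1/4 * ((fS z (R.F s) - fS z (R.F (R.φ k s)) - (R.x k s * R.Q k s) * fD z (R.F s)) * (R.x k s * R.P k s)))|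
      ≤ 2 * ex (fun s => |∑ k ∈ R.W, R.u4 k s| * fM z (R.F s)) := by
    refine (Finset.abs_sum_le_sum_abs _ _).trans ((Finset.sum_le_sum h3).trans ?_)
    rw [← Finset.mul_sum, ← ex_sum]
    refine mul_le_mul_of_nonneg_left (ex_mono fun s => ?_) (by norm_num)
    rw [← Finset.mul_sum, mul_comm]
    refine (le_abs_self _).trans ?_
    rw [abs_mul]
    exact mul_le_mul_of_nonneg_left (fH_bound z _ hz) (abs_nonneg _)
  have h5 : |ex (fun s => R.T s * fD z (R.F s)) - ex (fun s => fD z (R.F s))| ≤ ex (fun s => |R.T s - 1| * fM z (R.F s)) := by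
    rw [← ex_sub]
    refine (ex_abs_le _).trans (ex_mono fun s => ?_)
    rw [show R.T s * fD z (R.F s) - fD z (R.F s) = (R.T s - 1) * fD z (R.F s) by ring, abs_mul]
    exact mul_le_mul_of_nonneg_left (fD_bound z _ hz) (abs_nonneg _)
  rw [h1, h2]
  refine le_trans ?_ (add_le_add h5 h4)
  refine le_trans (le_of_eq ?_) (abs_add_le _ _)
  congr 1
  ring

lemma fM_int (c : ℝ) (z : ℝ) (hc : 0 < c) (hq : Real.exp (-z^2/2) ≤ c * (1+z) * gQ z) (hz : 0 ≤ z) (V : S → ℝ) (κ L : ℝ) (hκ : 0 ≤ κ) (hL : 0 ≤ L)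
    (h : ∀ y, 0 ≤ y → y ≤ z → ex (fun s => Real.exp (y * R.F s) * |V s|) ≤ κ * (1+y) * L * Real.exp (y^2/2)) :
    ex (fun s => |V s| * fM z (R.F s)) ≤ (7 + 2 * c) * κ * (1+z)^3 * L * gQ z := by
  have hQ := gQ_nonneg z
  have h0 : ex (fun s => |V s|) ≤ κ * L := by
    have := h 0 le_rfl hz
    simpa using this
  have h1 : ex (fun s => |V s| * hJ z (R.F s)) ≤ c * κ * (1+z)^2 * L * gQ z := by
    have a : ex (fun s => |V s| * hJ z (R.F s)) ≤ Real.exp (-z^2) * ex (fun s => Real.exp (z * R.F s) * |V s|) := by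
      rw [← ex_mul_left]
      refine ex_mono fun s => ?_
      rw [← mul_assoc, ← Real.exp_add, mul_comm]
      refine mul_le_mul_of_nonneg_right ?_ (abs_nonneg _)
      unfold hJ
      split_ifs with hh
      · exact (Real.exp_pos _).le
      · apply Real.one_le_exp
        nlinarith [not_le.mp hh]
    refine a.trans ?_
    have b := mul_le_mul_of_nonneg_left (h z hz le_rfl) (Real.exp_pos (-z^2)).le
    refine b.trans ?_
    have e : Real.exp (-z^2) * Real.exp (z^2/2) = Real.exp (-z^2/2) := by rw [← Real.exp_add]; congr 1; ring
    calc Real.exp (-z^2) * (κ * (1+z) * L * Real.exp (z^2/2)) = (κ * (1+z) * L) * (Real.exp (-z^2) * Real.exp (z^2/2)) := by ring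
      _ = (κ * (1+z) * L) * Real.exp (-z^2/2) := by rw [e]
      _ ≤ (κ * (1+z) * L) * (c * (1+z) * gQ z) := mul_le_mul_of_nonneg_left hq (by positivity)
      _ = _ := by ring
  have h2 : ex (fun s => |V s| * (if 0 ≤ R.F s ∧ R.F s ≤ z then R.F s * Real.exp ((R.F s)^2/2) else 0)) ≤ 2 * κ * (1+z)^3 * L := by
    have a : ex (fun s => |V s| * (if 0 ≤ R.F s ∧ R.F s ≤ z then R.F s * Real.exp ((R.F s)^2/2) else 0)) ≤
        ex (fun s => ∑ j ∈ Finset.range (⌊z⌋₊ + 1), (2 * z * Real.exp (-(j:ℝ)^2/2)) * (Real.exp (j * R.F s) * |V s|)) := by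
      refine ex_mono fun s => ?_
      have hpos : 0 ≤ ∑ j ∈ Finset.range (⌊z⌋₊ + 1), (2 * z * Real.exp (-(j:ℝ)^2/2)) * (Real.exp (j * R.F s) * |V s|) :=
        Finset.sum_nonneg fun j _ => by positivity
      split_ifs with hh
      · have e := exp_sq_le z (R.F s) hh.1 hh.2
        have e2 : R.F s * Real.exp ((R.F s)^2/2) ≤ z * (2 * ∑ j ∈ Finset.range (⌊z⌋₊ + 1), Real.exp (-(j:ℝ)^2/2) * Real.exp (j * R.F s)) :=
          mul_le_mul hh.2 e (Real.exp_pos _).le hz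
        refine (mul_le_mul_of_nonneg_left e2 (abs_nonneg _)).trans (le_of_eq ?_)
        rw [Finset.mul_sum, Finset.mul_sum, Finset.mul_sum]
        refine Finset.sum_congr rfl fun j _ => ?_
        ring
      · rw [mul_zero]; exact hpos
    refine a.trans ?_
    rw [ex_sum]
    have b : ∀ j ∈ Finset.range (⌊z⌋₊ + 1), ex (fun s => (2 * z * Real.exp (-(j:ℝ)^2/2)) * (Real.exp (j * R.F s) * |V s|)) ≤ 2 * z * (κ * (1+z) * L) := by
      intro j hj
      have hjz : (j:ℝ) ≤ z := (Nat.cast_le.2 (Nat.lt_succ_iff.1 (Finset.mem_range.1 hj))).trans (Nat.floor_le hz)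
      rw [ex_mul_left]
      have q := mul_le_mul_of_nonneg_left (h j (Nat.cast_nonneg j) hjz) (by positivity : 0 ≤ 2 * z * Real.exp (-(j:ℝ)^2/2))
      refine q.trans ?_
      have e : Real.exp (-(j:ℝ)^2/2) * Real.exp ((j:ℝ)^2/2) = 1 := by rw [← Real.exp_add]; simp [neg_div]
      calc 2 * z * Real.exp (-(j:ℝ)^2/2) * (κ * (1 + j) * L * Real.exp ((j:ℝ)^2/2)) = 2 * z * (κ * (1+j) * L) * (Real.exp (-(j:ℝ)^2/2) * Real.exp ((j:ℝ)^2/2)) := by ring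
        _ = 2 * z * (κ * (1+j) * L) := by rw [e, mul_one]
        _ ≤ _ := by gcongr
    refine (Finset.sum_le_sum b).trans ?_
    rw [Finset.sum_const, Finset.card_range, nsmul_eq_mul]
    have hf : ((⌊z⌋₊ + 1 : ℕ) : ℝ) ≤ 1 + z := by push_cast; linarith [Nat.floor_le hz]
    calc ((⌊z⌋₊ + 1 : ℕ) : ℝ) * (2 * z * (κ * (1+z) * L)) ≤ (1+z) * (2 * (1+z) * (κ * (1+z) * L)) := by
          gcongr; linarith
      _ = _ := by ring
  have e : (fun s => |V s| * fM z (R.F s)) = fun s => gQ z * |V s| + ((3 * gQ z) * (|V s| * (if 0 ≤ R.F s ∧ R.F s ≤ z then R.F s * Real.exp ((R.F s)^2/2) else 0))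
      + 2 * (|V s| * hJ z (R.F s))) := by
    funext s; unfold fM; ring
  rw [e, ex_add, ex_add, ex_mul_left, ex_mul_left, ex_mul_left]
  have p3 : (1:ℝ) ≤ (1+z)^3 := one_le_pow₀ (by linarith)
  have p2 : (1+z)^2 ≤ (1+z)^3 := pow_le_pow_right₀ (by linarith) (by norm_num)
  have c1 : gQ z * ex (fun s => |V s|) ≤ gQ z * (κ * L * (1+z)^3) := by
    refine mul_le_mul_of_nonneg_left (h0.trans ?_) hQ
    exact le_mul_of_one_le_right (by positivity) p3
  have c2 := mul_le_mul_of_nonneg_left h2 (by positivity : 0 ≤ 3 * gQ z)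
  have c3 : c * κ * (1+z)^2 * L * gQ z ≤ c * κ * (1+z)^3 * L * gQ z := by gcongr
  nlinarith

end RW

theorem core : ∃ c : ℝ, 0 < c ∧ ∀ (S : Type) [Fintype S] [Nonempty S] (R : RW S) (L z : ℝ),
    ex (fun s => R.F s * R.F s) = 1 → 0 ≤ L → ∑ k ∈ R.W, R.b k ^ 4 = L^2 → 0 ≤ z → z^2 * L ≤ 2 → z^3 * L ≤ 2 →
    |ex (fun s => hJ z (R.F s)) - gQ z| ≤ c * (1+z)^3 * L * gQ z := by
  obtain ⟨c, hc, hq⟩ := exp_le_gQ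
  set κ := 256 * Real.exp 6 * Real.exp (4096 * Real.exp 6) with hκ
  have hκ0 : 0 < κ := by positivity
  refine ⟨5 * ((7 + 2*c) * κ), by positivity, ?_⟩
  intro S _ _ R L z hv hL h4 hz h2 h3
  have hm : ∀ y, 0 ≤ y → y ≤ z → 256 * Real.exp 6 * (1+y) * L * R.m y ≤ κ * (1+y) * L * Real.exp (y^2/2) := by
    intro y hy hyz
    have := R.m_le hv L hL h4 y hy
      ((mul_le_mul_of_nonneg_right (pow_le_pow_left₀ hy hyz 2) hL).trans h2)
      ((mul_le_mul_of_nonneg_right (pow_le_pow_left₀ hy hyz 3) hL).trans h3)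
    calc _ ≤ 256 * Real.exp 6 * (1+y) * L * (Real.exp (4096 * Real.exp 6) * Real.exp (y^2/2)) :=
          mul_le_mul_of_nonneg_left this (by positivity)
      _ = _ := by rw [hκ]; ring
  have hy2 : ∀ y, 0 ≤ y → y ≤ z → y^2 * L ≤ 2 := fun y hy hyz =>
    (mul_le_mul_of_nonneg_right (pow_le_pow_left₀ hy hyz 2) hL).trans h2
  have a1 := R.fM_int c z hc (hq z hz) hz (fun s => R.T s - 1) (3 * κ) L (by positivity) hL (fun y hy hyz => by
    refine (R.tilt_T hv L hL h4 y hy (hy2 y hy hyz)).trans ?_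
    have := hm y hy hyz
    nlinarith)
  have a2 := R.fM_int c z hc (hq z hz) hz (fun s => ∑ k ∈ R.W, R.u4 k s) κ L (by positivity) hL (fun y hy hyz =>
    (R.tilt_u4 hv L hL h4 y hy (hy2 y hy hyz)).trans (hm y hy hyz))
  have := R.stein_dev z hz
  nlinarith


/-- the window of a finite index set -/
def Wset (s : Finset ℤ) : Finset ℤ := s ∪ s.image (fun i => i + 1)

lemma mem_Wset1 {s : Finset ℤ} {i : ℤ} (h : i ∈ s) : i ∈ Wset s := Finset.mem_union_left _ h
lemma mem_Wset2 {s : Finset ℤ} {i : ℤ} (h : i ∈ s) : i + 1 ∈ Wset s :=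
  Finset.mem_union_right _ (Finset.mem_image_of_mem (fun i : ℤ => i + 1) h)

noncomputable def RWof (s : Finset ℤ) (b : ℤ → ℝ) : RW (↥(Wset s) → Bool) where
  W := Wset s
  x := fun k σ => if h : k ∈ Wset s then (if σ ⟨k, h⟩ = true then 1 else -1) else 1
  φ := fun k σ => if h : k ∈ Wset s then Function.update σ ⟨k, h⟩ (!σ ⟨k, h⟩) else σ
  b := fun i => if i ∈ s then b i else 0
  hx := by
    intro k σ
    split_ifs <;> simp
  hinv := by
    intro k σ
    by_cases h : k ∈ Wset s
    · simp [h]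
    · simp [h]
  hflip := by
    intro k hk σ
    simp only [hk, dif_pos, Function.update_self]
    cases σ ⟨k, hk⟩ <;> simp
  hoth := by
    intro j k σ hjk
    by_cases h : k ∈ Wset s
    · by_cases hj : j ∈ Wset s
      · simp only [h, hj, dif_pos]
        rw [Function.update_of_ne]
        intro hh
        exact hjk (congrArg Subtype.val hh)
      · simp [hj]
    · simp [h]
  hb1 := by
    intro i hi
    rw [if_neg]
    exact fun h => hi (mem_Wset1 h)
  hb2 := by
    intro i hi
    rw [if_neg]
    exact fun h => hi (mem_Wset2 h)

section law
variable {Ω : Type*} [MeasurableSpace Ω] (μ : Measure Ω) [IsProbabilityMeasure μ]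
    (X : ℤ → Ω → ℝ) (hXmeas : ∀ i, Measurable (X i))
    (hval : ∀ i ω, X i ω = 1 ∨ X i ω = -1)
    (hind : iIndepFun X μ)
    (hhalf : ∀ i, μ {ω | X i ω = 1} = 1 / 2)

noncomputable def tauM (W : Finset ℤ) (ω : Ω) : ↥W → Bool := fun k => if X k ω = 1 then true else false

include hXmeas in
lemma tauM_meas (W : Finset ℤ) : Measurable (tauM X W) := by
  refine measurable_pi_lambda _ fun k => ?_
  exact Measurable.ite ((hXmeas k) (measurableSet_singleton 1)) measurable_const measurable_const

include hXmeas hval hind hhalf in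
lemma tauM_law (W : Finset ℤ) (σ : ↥W → Bool) : μ (tauM X W ⁻¹' {σ}) = (1/2)^W.card := by
  have hpre : tauM X W ⁻¹' {σ} = ⋂ k ∈ (Finset.univ : Finset ↥W), (X k) ⁻¹' {(if σ k = true then (1:ℝ) else -1)} := by
    ext ω
    simp only [Set.mem_preimage, Set.mem_singleton_iff, Finset.mem_univ, Set.iInter_true, Set.mem_iInter]
    constructor
    · intro h k
      rw [← h]
      unfold tauM
      rcases hval k ω with h1 | h1 <;> rw [h1] <;> norm_num
    · intro h
      funext k
      have := h k
      unfold tauM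
      rw [this]
      cases σ k <;> norm_num
  have hi := hind.precomp (g := fun k : ↥W => (k : ℤ)) Subtype.val_injective
  rw [hpre]
  have := hi.measure_inter_preimage_eq_mul Finset.univ (sets := fun k => {(if σ k = true then (1:ℝ) else -1)})
    (fun _ _ => measurableSet_singleton _)
  refine this.trans ?_
  have hk : ∀ k : ↥W, μ ((X k) ⁻¹' {(if σ k = true then (1:ℝ) else -1)}) = 1/2 := by
    intro k
    cases σ k
    · have e : (X k) ⁻¹' {(if false = true then (1:ℝ) else -1)} = {ω | X k ω = 1}ᶜ := by
        ext ω
        rcases hval k ω with h1 | h1 <;> simp [h1] <;> norm_num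
      have hms : MeasurableSet {ω | X k ω = 1} := (hXmeas k) (measurableSet_singleton 1)
      rw [e, prob_compl_eq_one_sub hms, hhalf]
      simp
    · exact hhalf k
  rw [Finset.prod_congr rfl fun k _ => hk k]
  simp

include hXmeas hval hind hhalf in
lemma tauM_int (W : Finset ℤ) (H : (↥W → Bool) → ℝ) : ∫ ω, H (tauM X W ω) ∂μ = ex H := by
  have hm := tauM_meas X hXmeas W
  rw [← integral_map (f := H) hm.aemeasurable (by measurability)]
  have : IsFiniteMeasure (μ.map (tauM X W)) := inferInstance
  rw [integral_fintype (Integrable.of_finite)]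
  unfold ex
  rw [Finset.sum_div]
  refine Finset.sum_congr rfl fun σ _ => ?_
  rw [Measure.real, Measure.map_apply hm (measurableSet_singleton σ), tauM_law μ X hXmeas hval hind hhalf]
  simp
  ring

noncomputable def Gs (a : ℤ → ℝ) (s : Finset ℤ) (ω : Ω) : ℝ :=
  ∑ i ∈ s, a i * ((X i ω + 1) / 2) * ((X (i + 1) ω + 1) / 2)
noncomputable def Ms (a : ℤ → ℝ) (s : Finset ℤ) : ℝ := ∑ i ∈ s, a i / 4

include hval in
lemma RWof_F (a : ℤ → ℝ) (s : Finset ℤ) (d : ℝ) (ω : Ω) :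
    (RWof s (fun i => a i / d)).F (tauM X (Wset s) ω) = (Gs X a s ω - Ms a s) / d := by
  unfold RW.F Gs Ms
  rw [← Finset.sum_sub_distrib, Finset.sum_div]
  have hx : ∀ k ∈ Wset s, (RWof s (fun i => a i / d)).x k (tauM X (Wset s) ω) = X k ω := by
    intro k hk
    have e1 : (RWof s (fun i => a i / d)).x k (tauM X (Wset s) ω) = if tauM X (Wset s) ω ⟨k, hk⟩ = true then 1 else -1 := dif_pos hk
    rw [e1]
    rcases hval k ω with h1 | h1
    · have : tauM X (Wset s) ω ⟨k, hk⟩ = true := if_pos h1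
      rw [this, h1]; norm_num
    · have : tauM X (Wset s) ω ⟨k, hk⟩ = false := if_neg (by rw [h1]; norm_num)
      rw [this, h1]; norm_num
  symm
  refine Finset.sum_subset_zero_on_sdiff (fun i hi => mem_Wset1 hi) ?_ ?_
  · intro i hi
    have : (RWof s (fun i => a i / d)).b i = 0 := if_neg (Finset.mem_sdiff.1 hi).2
    rw [this]; ring
  · intro i hi
    have : (RWof s (fun i => a i / d)).b i = a i / d := if_pos hi
    rw [this, hx i (mem_Wset1 hi), hx (i+1) (mem_Wset2 hi)]
    ring

include hXmeas hval hind hhalf in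
lemma Gs_mean (a : ℤ → ℝ) (s : Finset ℤ) : ∫ ω, (Gs X a s ω - Ms a s) ∂μ = 0 := by
  have h : ∀ ω, Gs X a s ω - Ms a s = (RWof s (fun i => a i / 1)).F (tauM X (Wset s) ω) := by
    intro ω; rw [RWof_F X hval, div_one]
  simp only [h]
  rw [tauM_int μ X hXmeas hval hind hhalf]
  have := (RWof s (fun i => a i / 1)).stein (fun _ => 1)
  simp only [mul_one, sub_self, zero_mul] at this
  refine this.trans ?_
  refine Finset.sum_eq_zero fun k _ => ?_
  rw [ex_const, mul_zero]

noncomputable def Vs (a : ℤ → ℝ) (s : Finset ℤ) : ℝ := ∫ ω, (Gs X a s ω - Ms a s)^2 ∂μ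

include hXmeas hval hind hhalf in
lemma finite_thm (c : ℝ) (hcore : ∀ (S : Type) [Fintype S] [Nonempty S] (R : RW S) (L z : ℝ),
    ex (fun s => R.F s * R.F s) = 1 → 0 ≤ L → ∑ k ∈ R.W, R.b k ^ 4 = L^2 → 0 ≤ z → z^2 * L ≤ 2 → z^3 * L ≤ 2 →
    |ex (fun s => hJ z (R.F s)) - gQ z| ≤ c * (1+z)^3 * L * gQ z)
    (a : ℤ → ℝ) (s : Finset ℤ) (hV : 0 < Vs μ X a s) (L z : ℝ)
    (hLdef : L = Real.sqrt (∑ i ∈ s, a i ^ 4) / Vs μ X a s) (hz : 0 ≤ z) (h2 : z^2 * L ≤ 2) (h3 : z^3 * L ≤ 2) :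
    |μ.real {ω | (Gs X a s ω - Ms a s) / Real.sqrt (Vs μ X a s) > z} - gQ z| ≤ c * (1+z)^3 * L * gQ z := by
  set d := Real.sqrt (Vs μ X a s) with hd
  have hd0 : 0 < d := Real.sqrt_pos.2 hV
  have hd2 : d^2 = Vs μ X a s := Real.sq_sqrt hV.le
  have hL : 0 ≤ L := by rw [hLdef]; positivity
  have hF := RWof_F X hval a s d
  have key := hcore _ (RWof s (fun i => a i / d)) L z ?_ hL ?_ hz h2 h3
  · have e : μ.real {ω | (Gs X a s ω - Ms a s) / d > z} = ex (fun σ => hJ z ((RWof s (fun i => a i / d)).F σ)) := by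
      rw [← tauM_int μ X hXmeas hval hind hhalf]
      simp only [hF]
      have hms : MeasurableSet {ω | (Gs X a s ω - Ms a s) / d > z} := by
        refine measurableSet_lt measurable_const ?_
        unfold Gs
        fun_prop
      rw [← integral_indicator_one hms]
      refine integral_congr_ae (Filter.Eventually.of_forall fun ω => ?_)
      simp only [Set.indicator, Set.mem_setOf_eq, hJ, Pi.one_apply]
      by_cases h : (Gs X a s ω - Ms a s) / d > z
      · rw [if_pos h, if_neg (not_le.2 h)]
      · rw [if_neg h, if_pos (not_lt.1 h)]
    rw [e]; exact key
  · rw [← tauM_int μ X hXmeas hval hind hhalf]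
    simp only [hF]
    have : ∀ ω, (Gs X a s ω - Ms a s) / d * ((Gs X a s ω - Ms a s) / d) = (Gs X a s ω - Ms a s)^2 / d^2 := by
      intro ω; ring
    simp only [this]
    rw [integral_div, hd2]
    exact div_self hV.ne'
  · have e : ∑ k ∈ (RWof s (fun i => a i / d)).W, (RWof s (fun i => a i / d)).b k ^ 4 = ∑ i ∈ s, (a i / d)^4 := by
      symm
      refine Finset.sum_subset_zero_on_sdiff (fun i hi => mem_Wset1 hi) ?_ ?_
      · intro i hi
        have : (RWof s (fun i => a i / d)).b i = 0 := if_neg (Finset.mem_sdiff.1 hi).2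
        rw [this]; norm_num
      · intro i hi
        have : (RWof s (fun i => a i / d)).b i = a i / d := if_pos hi
        rw [this]
    rw [e, hLdef, div_pow, Real.sq_sqrt (Finset.sum_nonneg fun i _ => by positivity), ← hd2, Finset.sum_div]
    refine Finset.sum_congr rfl fun i _ => ?_
    rw [div_pow, ← pow_mul]

end law


section lim
variable {Ω : Type*} [MeasurableSpace Ω] (μ : Measure Ω) [IsProbabilityMeasure μ]

lemma limit_arg {ι : Type*} (l : Filter ι) [l.NeBot] (F : Ω → ℝ) (Fs : ι → Ω → ℝ) (e Ls : ι → ℝ) (L c z : ℝ)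
    (he : Filter.Tendsto e l (nhds 0)) (hF : ∀ᶠ i in l, ∀ ω, |Fs i ω - F ω| ≤ e i)
    (hLs : Filter.Tendsto Ls l (nhds L)) (hz : 0 ≤ z) (h2 : z^2 * L ≤ 1) (h3 : z^3 * L ≤ 1)
    (h : ∀ᶠ i in l, ∀ z, 0 ≤ z → z^2 * Ls i ≤ 2 → z^3 * Ls i ≤ 2 →
      |μ.real {ω | Fs i ω > z} - gQ z| ≤ c * (1+z)^3 * Ls i * gQ z) :
    |μ.real {ω | F ω > z} - gQ z| ≤ c * (1+z)^3 * L * gQ z := by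
  have hgc : Continuous gQ := continuous_iff_continuousAt.2 fun x => (gQ_deriv x).continuousAt
  have hev : ∀ y, y^2 * L < 2 → y^3 * L < 2 → ∀ᶠ i in l, y^2 * Ls i ≤ 2 ∧ y^3 * Ls i ≤ 2 := by
    intro y hy2 hy3
    have t2 : Filter.Tendsto (fun i => y^2 * Ls i) l (nhds (y^2 * L)) := hLs.const_mul _
    have t3 : Filter.Tendsto (fun i => y^3 * Ls i) l (nhds (y^3 * L)) := hLs.const_mul _
    filter_upwards [t2.eventually_lt_const hy2, t3.eventually_lt_const hy3] with i a b
    exact ⟨a.le, b.le⟩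
  have hlim : ∀ y, Filter.Tendsto (fun i => c * (1+y)^3 * Ls i * gQ y) l (nhds (c * (1+y)^3 * L * gQ y)) := by
    intro y
    exact (hLs.const_mul _).mul_const _
  have up : μ.real {ω | F ω > z} ≤ gQ z + c * (1+z)^3 * L * gQ z := by
    have h1 : ∀ δ, 0 < δ → μ.real {ω | F ω > z + δ} ≤ gQ z + c * (1+z)^3 * L * gQ z := by
      intro δ hδ
      refine ge_of_tendsto ((hlim z).const_add (gQ z)) ?_
      filter_upwards [hF, h, hev z (by linarith) (by linarith), he.eventually_lt_const hδ] with i a b cc d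
      have b1 := (abs_le.1 (b z hz cc.1 cc.2)).2
      have : μ.real {ω | F ω > z + δ} ≤ μ.real {ω | Fs i ω > z} := by
        refine measureReal_mono ?_ (measure_ne_top _ _)
        intro ω hω
        have hω' : F ω > z + δ := hω
        have := (abs_le.1 (a ω)).1
        change Fs i ω > z
        linarith
      linarith
    have hU : {ω | F ω > z} = ⋃ n : ℕ, {ω | F ω > z + 1 / ((n:ℝ) + 1)} := by
      ext ω
      rw [Set.mem_iUnion]
      constructor
      · intro hω
        have hω' : F ω > z := hω
        obtain ⟨n, hn⟩ := exists_nat_one_div_lt (sub_pos.2 hω')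
        refine ⟨n, ?_⟩
        change F ω > z + 1 / ((n:ℝ) + 1)
        linarith
      · rintro ⟨n, hn⟩
        have hn' : F ω > z + 1 / ((n:ℝ) + 1) := hn
        have : (0:ℝ) < 1 / ((n:ℝ) + 1) := by positivity
        change F ω > z
        linarith
    have hmono : Monotone fun n : ℕ => {ω | F ω > z + 1 / ((n:ℝ) + 1)} := by
      intro n m hnm ω hω
      have hn' : F ω > z + 1 / ((n:ℝ) + 1) := hω
      have := Nat.one_div_le_one_div (α := ℝ) hnm
      change F ω > z + 1 / ((m:ℝ) + 1)
      linarith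
    have ht := tendsto_measure_iUnion_atTop (μ := μ) hmono
    rw [← hU] at ht
    have ht2 := (ENNReal.tendsto_toReal (measure_ne_top μ {ω | F ω > z})).comp ht
    refine le_of_tendsto ht2 (Filter.Eventually.of_forall fun n => ?_)
    exact h1 _ (by positivity)
  have lo : gQ z - c * (1+z)^3 * L * gQ z ≤ μ.real {ω | F ω > z} := by
    have hc2 : Filter.Tendsto (fun δ : ℝ => (z+δ)^2 * L) (nhds 0) (nhds (z^2 * L)) := by
      have : Continuous (fun δ : ℝ => (z+δ)^2 * L) := by fun_prop
      simpa using this.tendsto 0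
    have hc3 : Filter.Tendsto (fun δ : ℝ => (z+δ)^3 * L) (nhds 0) (nhds (z^3 * L)) := by
      have : Continuous (fun δ : ℝ => (z+δ)^3 * L) := by fun_prop
      simpa using this.tendsto 0
    have hcc : Filter.Tendsto (fun δ : ℝ => gQ (z+δ) - c * (1+(z+δ))^3 * L * gQ (z+δ)) (nhds 0) (nhds (gQ z - c * (1+z)^3 * L * gQ z)) := by
      have : Continuous (fun δ : ℝ => gQ (z+δ) - c * (1+(z+δ))^3 * L * gQ (z+δ)) := by fun_prop
      simpa using this.tendsto 0
    refine le_of_tendsto (hcc.mono_left (nhdsWithin_le_nhds (s := Set.Ioi 0))) ?_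
    have e2 := (hc2.mono_left (nhdsWithin_le_nhds (s := Set.Ioi 0))).eventually_lt_const (show z^2 * L < 2 by linarith)
    have e3 := (hc3.mono_left (nhdsWithin_le_nhds (s := Set.Ioi 0))).eventually_lt_const (show z^3 * L < 2 by linarith)
    filter_upwards [e2, e3, self_mem_nhdsWithin] with δ d2 d3 hδ
    have hδ' : 0 < δ := hδ
    refine le_of_tendsto ((hlim (z+δ)).const_sub (gQ (z+δ))) ?_
    filter_upwards [hF, h, hev (z+δ) d2 d3, he.eventually_lt_const hδ'] with i a b cc d
    have b1 := (abs_le.1 (b (z+δ) (by linarith) cc.1 cc.2)).1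
    have : μ.real {ω | Fs i ω > z + δ} ≤ μ.real {ω | F ω > z} := by
      refine measureReal_mono ?_ (measure_ne_top _ _)
      intro ω hω
      have hω' : Fs i ω > z + δ := hω
      have := (abs_le.1 (a ω)).2
      change F ω > z
      linarith
    linarith
  rw [abs_le]
  constructor <;> linarith

variable (X : ℤ → Ω → ℝ) (hXmeas : ∀ i, Measurable (X i))
    (hval : ∀ i ω, X i ω = 1 ∨ X i ω = -1)
    (hind : iIndepFun X μ)
    (hhalf : ∀ i, μ {ω | X i ω = 1} = 1 / 2)
    (a : ℤ → ℝ) (ha : Summable fun i : ℤ => |a i|)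

include hval in
lemma term_bd (i : ℤ) (ω : Ω) : |a i * ((X i ω + 1) / 2) * ((X (i + 1) ω + 1) / 2)| ≤ |a i| := by
  rcases hval i ω with h | h <;> rcases hval (i+1) ω with h' | h' <;> rw [h, h'] <;> norm_num

include hval ha in
lemma Gs_close (s : Finset ℤ) (ω : Ω) : |Gs X a s ω - twoRunG X a ω| ≤ ∑' i, |a i| - ∑ i ∈ s, |a i| := by
  have hb := fun i => abs_le.1 (term_bd X hval a i ω)
  have hs : Summable fun i => a i * ((X i ω + 1) / 2) * ((X (i + 1) ω + 1) / 2) :=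
    Summable.of_norm_bounded ha fun i => term_bd X hval a i ω
  have h1 := (ha.sub hs).sum_le_tsum s (fun i _ => by linarith [(hb i).2])
  have h2 := (ha.add hs).sum_le_tsum s (fun i _ => by linarith [(hb i).1])
  rw [Finset.sum_sub_distrib, ha.tsum_sub hs] at h1
  rw [Finset.sum_add_distrib, ha.tsum_add hs] at h2
  unfold Gs twoRunG
  rw [abs_le]
  constructor <;> linarith

include hval in
lemma Gs_bd (ha : Summable fun i : ℤ => |a i|) (s : Finset ℤ) (ω : Ω) : |Gs X a s ω| ≤ ∑' i, |a i| := by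
  unfold Gs
  refine (Finset.abs_sum_le_sum_abs _ _).trans ((Finset.sum_le_sum fun i _ => term_bd X hval a i ω).trans ?_)
  exact ha.sum_le_tsum s (fun i _ => abs_nonneg _)

include hXmeas in
lemma Gs_meas (s : Finset ℤ) : Measurable (Gs X a s) := by
  unfold Gs; fun_prop

lemma tail_tendsto (ha : Summable fun i : ℤ => |a i|) :
    Filter.Tendsto (fun s : Finset ℤ => ∑' i, |a i| - ∑ i ∈ s, |a i|) Filter.atTop (nhds 0) := by
  have := (ha.hasSum.const_sub (∑' i, |a i|))
  simpa using this

include hval ha in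
lemma Gs_tendsto (ω : Ω) : Filter.Tendsto (fun s => Gs X a s ω) Filter.atTop (nhds (twoRunG X a ω)) := by
  rw [tendsto_iff_dist_tendsto_zero]
  exact squeeze_zero (fun _ => dist_nonneg) (fun s => by rw [Real.dist_eq]; exact Gs_close X hval a ha s ω) (tail_tendsto a ha)

include hXmeas hval in
lemma Gs_integrable (ha : Summable fun i : ℤ => |a i|) (s : Finset ℤ) : Integrable (Gs X a s) μ :=
  Integrable.of_bound (Gs_meas X hXmeas a s).aestronglyMeasurable (∑' i, |a i|)
    (Filter.Eventually.of_forall fun ω => Gs_bd X hval a ha s ω)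

include hXmeas hval in
lemma Gs_sq_integrable (ha : Summable fun i : ℤ => |a i|) (s : Finset ℤ) : Integrable (fun ω => Gs X a s ω ^ 2) μ :=
  Integrable.of_bound ((Gs_meas X hXmeas a s).pow_const 2).aestronglyMeasurable ((∑' i, |a i|)^2)
    (Filter.Eventually.of_forall fun ω => by
      rw [Real.norm_eq_abs, abs_pow]
      exact pow_le_pow_left₀ (abs_nonneg _) (Gs_bd X hval a ha s ω) 2)

include hXmeas hval hind hhalf in
lemma Ms_eq (ha : Summable fun i : ℤ => |a i|) (s : Finset ℤ) : Ms a s = ∫ ω, Gs X a s ω ∂μ := by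
  have h := Gs_mean μ X hXmeas hval hind hhalf a s
  rw [integral_sub (Gs_integrable μ X hXmeas hval a ha s) (integrable_const _)] at h
  simp at h
  linarith

include hXmeas hval hind hhalf in
lemma Ms_tendsto (ha : Summable fun i : ℤ => |a i|) : Filter.Tendsto (Ms a) Filter.atTop (nhds (twoRunMean μ X a)) := by
  have : Ms a = fun s => ∫ ω, Gs X a s ω ∂μ := funext fun s => Ms_eq μ X hXmeas hval hind hhalf a ha s
  rw [this]
  refine tendsto_integral_filter_of_dominated_convergence (fun _ => ∑' i, |a i|) ?_ ?_ (integrable_const _) ?_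
  · exact Filter.Eventually.of_forall fun s => (Gs_meas X hXmeas a s).aestronglyMeasurable
  · exact Filter.Eventually.of_forall fun s => Filter.Eventually.of_forall fun ω => Gs_bd X hval a ha s ω
  · exact Filter.Eventually.of_forall fun ω => Gs_tendsto X hval a ha ω

include hXmeas hval hind hhalf in
lemma Vs_tendsto (ha : Summable fun i : ℤ => |a i|) : Filter.Tendsto (Vs μ X a) Filter.atTop (nhds (twoRunVar μ X a)) := by
  have : Vs μ X a = fun s => (∫ ω, Gs X a s ω ^ 2 ∂μ) - (Ms a s)^2 := by
    funext s
    unfold Vs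
    have e : ∀ ω, (Gs X a s ω - Ms a s)^2 = (Gs X a s ω ^ 2 - (2 * Ms a s) * Gs X a s ω) + (Ms a s)^2 := by intro ω; ring
    have i1 := Gs_sq_integrable μ X hXmeas hval a ha s
    have i2 := (Gs_integrable μ X hXmeas hval a ha s).const_mul (2 * Ms a s)
    simp only [e]
    have i3 : Integrable (fun ω => Gs X a s ω ^ 2 - (2 * Ms a s) * Gs X a s ω) μ := i1.sub i2
    rw [integral_add i3 (integrable_const _), integral_sub i1 i2, integral_const_mul,
      ← Ms_eq μ X hXmeas hval hind hhalf a ha s]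
    simp
    ring
  rw [this]
  refine Filter.Tendsto.sub ?_ ((Ms_tendsto μ X hXmeas hval hind hhalf a ha).pow 2)
  refine tendsto_integral_filter_of_dominated_convergence (fun _ => (∑' i, |a i|)^2) ?_ ?_ (integrable_const _) ?_
  · exact Filter.Eventually.of_forall fun s => ((Gs_meas X hXmeas a s).pow_const 2).aestronglyMeasurable
  · refine Filter.Eventually.of_forall fun s => Filter.Eventually.of_forall fun ω => ?_
    rw [Real.norm_eq_abs, abs_pow]
    exact pow_le_pow_left₀ (abs_nonneg _) (Gs_bd X hval a ha s ω) 2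
  · exact Filter.Eventually.of_forall fun ω => (Gs_tendsto X hval a ha ω).pow 2

lemma sum_four (ha : Summable fun i : ℤ => |a i|) : Summable fun i : ℤ => a i ^ 4 := by
  refine Summable.of_nonneg_of_le (fun i => by positivity) (fun i => ?_) (ha.mul_left ((∑' i, |a i|)^3))
  have h : |a i| ≤ ∑' i, |a i| := ha.le_tsum i (fun j _ => abs_nonneg _)
  have e : a i ^ 4 = |a i|^3 * |a i| := by
    rw [← pow_succ]; exact ((by decide : Even 4).pow_abs (a i)).symm
  rw [e]
  gcongr

include hXmeas hval hind hhalf in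
lemma infinite_thm (c : ℝ) (hcore : ∀ (S : Type) [Fintype S] [Nonempty S] (R : RW S) (L z : ℝ),
    ex (fun s => R.F s * R.F s) = 1 → 0 ≤ L → ∑ k ∈ R.W, R.b k ^ 4 = L^2 → 0 ≤ z → z^2 * L ≤ 2 → z^3 * L ≤ 2 →
    |ex (fun s => hJ z (R.F s)) - gQ z| ≤ c * (1+z)^3 * L * gQ z)
    (ha : Summable fun i : ℤ => |a i|) (hV : 0 < twoRunVar μ X a) (z : ℝ) (hz : 0 ≤ z)
    (h2 : z^2 * twoRunC μ X a ≤ 1) (h3 : z^3 * twoRunC μ X a ≤ 1) :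
    |μ.real {ω | twoRunF μ X a ω > z} - gQ z| ≤ c * (1+z)^3 * twoRunC μ X a * gQ z := by
  have tV := Vs_tendsto μ X hXmeas hval hind hhalf a ha
  have tM := Ms_tendsto μ X hXmeas hval hind hhalf a ha
  have tr := tail_tendsto a ha
  have tp : Filter.Tendsto (fun s => (Real.sqrt (Vs μ X a s))⁻¹) Filter.atTop (nhds (Real.sqrt (twoRunVar μ X a))⁻¹) :=
    ((Real.continuous_sqrt.tendsto _).comp tV).inv₀ (Real.sqrt_pos.2 hV).ne'
  have tL : Filter.Tendsto (fun s => Real.sqrt (∑ i ∈ s, a i ^ 4) / Vs μ X a s) Filter.atTop (nhds (twoRunC μ X a)) := by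
    unfold twoRunC
    exact ((Real.continuous_sqrt.tendsto _).comp (sum_four a ha).hasSum).div tV hV.ne'
  set p := (Real.sqrt (twoRunVar μ X a))⁻¹ with hp
  set m := twoRunMean μ X a with hm
  let e : Finset ℤ → ℝ := fun s => ((∑' i, |a i| - ∑ i ∈ s, |a i|) + |Ms a s - m|) * (Real.sqrt (Vs μ X a s))⁻¹
    + (∑' i, |a i| + |m|) * |(Real.sqrt (Vs μ X a s))⁻¹ - p|
  have te : Filter.Tendsto e Filter.atTop (nhds 0) := by
    have q1 : Filter.Tendsto (fun s => |Ms a s - m|) Filter.atTop (nhds 0) := by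
      simpa using (tM.sub_const m).abs
    have q2 : Filter.Tendsto (fun s => |(Real.sqrt (Vs μ X a s))⁻¹ - p|) Filter.atTop (nhds 0) := by
      simpa using (tp.sub_const p).abs
    have := ((tr.add q1).mul tp).add (q2.const_mul (∑' i, |a i| + |m|))
    simpa using this
  refine limit_arg μ Filter.atTop (twoRunF μ X a) (fun s ω => (Gs X a s ω - Ms a s) / Real.sqrt (Vs μ X a s)) e
    (fun s => Real.sqrt (∑ i ∈ s, a i ^ 4) / Vs μ X a s) (twoRunC μ X a) c z te ?_ tL hz h2 h3 ?_
  · refine Filter.Eventually.of_forall fun s ω => ?_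
    have hG : |twoRunG X a ω| ≤ ∑' i, |a i| :=
      le_of_tendsto (Gs_tendsto X hval a ha ω).abs (Filter.Eventually.of_forall fun s => Gs_bd X hval a ha s ω)
    have hc := Gs_close X hval a ha s ω
    unfold twoRunF
    rw [div_eq_mul_inv, div_eq_mul_inv, ← hp, ← hm]
    set q := (Real.sqrt (Vs μ X a s))⁻¹ with hq
    have hq0 : 0 ≤ q := by positivity
    have e1 : (Gs X a s ω - Ms a s) * q - (twoRunG X a ω - m) * p =
      ((Gs X a s ω - twoRunG X a ω) - (Ms a s - m)) * q + (twoRunG X a ω - m) * (q - p) := by ring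
    rw [e1]
    refine (abs_add_le _ _).trans ?_
    rw [abs_mul, abs_mul, abs_of_nonneg hq0]
    refine add_le_add ?_ ?_
    · refine mul_le_mul_of_nonneg_right ?_ hq0
      exact (abs_sub _ _).trans (add_le_add_left hc _)
    · refine mul_le_mul_of_nonneg_right ?_ (abs_nonneg _)
      exact (abs_sub _ _).trans (add_le_add_left hG _)
  · filter_upwards [tV.eventually_const_lt hV] with s hs y hy y2 y3
    exact finite_thm μ X hXmeas hval hind hhalf c hcore a s hs _ y rfl hy y2 y3

end lim

/-- Moderate deviations for infinite weighted 2-runs: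
there exist constants `C, K > 0` (depending only on the family of coefficient sequences) such
that for every `n` and every `z` with
`0 ≤ z ≤ min{C_n^{−1/5}, C_n^{−1/3}, C_n^{−2/5}, Var(G_n)^{1/2}}` and `(1+z²)γ_n(z) ≤ 1`,
`|ℙ(F_n > z)/(1 − Φ(z)) − 1| ≤ C·(1+z²)·γ_n(z)`. -/
theorem stmt_0 {Ω : Type*} [MeasurableSpace Ω] (μ : Measure Ω) [IsProbabilityMeasure μ]
    (X : ℤ → Ω → ℝ) (hXmeas : ∀ i, Measurable (X i))
    (hval : ∀ i ω, X i ω = 1 ∨ X i ω = -1)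
    (hind : iIndepFun X μ)
    (hhalf : ∀ i, μ {ω | X i ω = 1} = 1 / 2)
    (a : ℕ → ℤ → ℝ) (ha : ∀ n, Summable fun i : ℤ => |a n i|)
    (hvar : ∀ n, 0 < twoRunVar μ X (a n)) :
    ∃ C K : ℝ, 0 < C ∧ 0 < K ∧ ∀ n : ℕ, ∀ z : ℝ,
      0 ≤ z →
      z ≤ min (min ((twoRunC μ X (a n)) ^ (-(1 / 5) : ℝ)) ((twoRunC μ X (a n)) ^ (-(1 / 3) : ℝ)))
            (min ((twoRunC μ X (a n)) ^ (-(2 / 5) : ℝ)) (Real.sqrt (twoRunVar μ X (a n)))) →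
      (1 + z ^ 2) * twoRunγ μ X (a n) K z ≤ 1 →
      |(μ {ω | twoRunF μ X (a n) ω > z}).toReal / (1 - stdNormalCDF z) - 1| ≤
        C * (1 + z ^ 2) * twoRunγ μ X (a n) K z := by
  obtain ⟨c, hc, hcore⟩ := core
  refine ⟨2 * c, 1, by positivity, one_pos, ?_⟩
  intro n z hz _ hγ
  have hV := hvar n
  set Cn := twoRunC μ X (a n) with hCn
  have hC0 : 0 ≤ Cn := by rw [hCn]; unfold twoRunC; positivity
  have hle : (1 + z) * Cn ≤ twoRunγ μ X (a n) 1 z := by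
    unfold twoRunγ
    rw [← hCn]
    have h1 : 1 ≤ Real.exp (1 * z / Real.sqrt (twoRunVar μ X (a n))) := Real.one_le_exp (by positivity)
    have h2 : (1 + z) * Cn ≤ Real.sqrt z * Real.sqrt Cn + (1 + Real.sqrt z + z) * Cn := by
      have q1 : 0 ≤ Real.sqrt z * Real.sqrt Cn := by positivity
      have q2 : 0 ≤ Real.sqrt z * Cn := by positivity
      nlinarith
    refine h2.trans (le_mul_of_one_le_left ?_ h1)
    exact le_trans (by positivity) h2
  set γ := twoRunγ μ X (a n) 1 z with hg
  have hle2 : (1 + z^2) * ((1 + z) * Cn) ≤ 1 := (mul_le_mul_of_nonneg_left hle (by positivity)).trans hγ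
  have p1 : 0 ≤ z * Cn := by positivity
  have p2 : 0 ≤ z^2 * Cn := by positivity
  have p3 : 0 ≤ z^3 * Cn := by positivity
  have h2 : z^2 * Cn ≤ 1 := by nlinarith
  have h3 : z^3 * Cn ≤ 1 := by nlinarith
  have key := infinite_thm μ X hXmeas hval hind hhalf (a n) c hcore (ha n) hV z hz h2 h3
  rw [← hCn] at key
  have hQ := gQ_pos z
  have e : (μ {ω | twoRunF μ X (a n) ω > z}).toReal / (1 - stdNormalCDF z) - 1 =
      (μ.real {ω | twoRunF μ X (a n) ω > z} - gQ z) / gQ z := by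
    rw [sub_div, div_self hQ.ne']; rfl
  rw [e, abs_div, abs_of_pos hQ, div_le_iff₀ hQ]
  refine key.trans (mul_le_mul_of_nonneg_right ?_ hQ.le)
  have h4 : (1+z)^2 ≤ 2 * (1+z^2) := by nlinarith [sq_nonneg (1-z)]
  calc c * (1+z)^3 * Cn = c * ((1+z)^2 * ((1+z) * Cn)) := by ring
    _ ≤ c * ((2 * (1+z^2)) * γ) := by gcongr
    _ = 2 * c * (1+z^2) * γ := by ring
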